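/- arXiv:1302.1414 — 2 statements merged into one kernel-verified Lean document; each statement's English description precedes it below -/
import Mathlib

section
/- There exists δ_3 ∈ (0,δ_2) such that for all λ ∈ [−δ_3,δ_3], ω ∈ [1−δ_3,1+δ_3], and v ∈ im Q with ‖v‖_∞ ≤ δ_3, there exists exactly one w ∈ ker Q with ‖w‖_∞ ≤ δ_3 solving the infinite-dimensional Liapunov–Schmidt equation (I − P)((I − C(λ,ω))(v + w) − F(λ,ω,v + w)) = 0; this solution is denoted ŵ(λ,ω,v). -/
open Real Set MeasureTheory Filter Topology

noncomputable section

instance fact_two_pi_pos : Fact (0 < 2 * Real.pi) := ⟨by positivity⟩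

/-- The time circle of length `2π` (continuous `2π`-time-periodic functions of `t ∈ ℝ`
are identified with continuous functions on this circle). -/
abbrev TimeCircle : Type := AddCircle (2 * Real.pi)

/-- The domain `[0,1] × (ℝ / 2πℤ)`. -/
abbrev Dom : Type := Set.Icc (0:ℝ) 1 × TimeCircle

/-- The Banach space `C_n` of continuous `2π`-time-periodic maps `u : [0,1] × ℝ → ℝⁿ`
with the sup-norm, realized as the space of continuous maps on the compact set `Dom`. -/
abbrev Cspace (n : ℕ) : Type := C(Dom, Fin n → ℝ)

/-- Evaluation of an element of `Cspace n` at real coordinates `(x,t)`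
(extended constantly outside `[0,1]` in the `x`-variable). -/
def ev {n : ℕ} (u : Cspace n) (x t : ℝ) : Fin n → ℝ :=
  u (Set.projIcc (0:ℝ) 1 zero_le_one x, (t : TimeCircle))

/-- The boundary point `x_j`: `0` for `j = 1,…,m` and `1` for `j = m+1,…,n`
(with 0-based indices: `0` for `j < m`, `1` for `j ≥ m`). -/
def xjv (m : ℕ) {n : ℕ} (j : Fin n) : ℝ := if (j : ℕ) < m then 0 else 1

/-- The data of the problem: coefficients `a_j(x,λ)`, nonlinearities `b_j(x,λ,u)`
and reflection coefficients `r_{jk}`, for a system of `n` equations with `m`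
components running to the right. -/
structure HypData (n m : ℕ) where
  a : Fin n → ℝ → ℝ → ℝ
  b : Fin n → ℝ → ℝ → (Fin n → ℝ) → ℝ
  r : Fin n → Fin n → ℝ

namespace HypData

variable {n m : ℕ} (d : HypData n m)

/-- `∂_{u_k} b_j (x, λ, 0)`. -/
def dbu (j k : Fin n) (x lam : ℝ) : ℝ := fderiv ℝ (d.b j x lam) 0 (Pi.single k 1)

/-- `∂²_{u_k u_l} b_j (x, λ, 0)`. -/
def dbu2 (j k l : Fin n) (x lam : ℝ) : ℝ :=
  fderiv ℝ (fun v => fderiv ℝ (d.b j x lam) v (Pi.single l 1)) 0 (Pi.single k 1)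

/-- `∂³_{u_k u_l u_r} b_j (x, λ, 0)`. -/
def dbu3 (j k l rr : Fin n) (x lam : ℝ) : ℝ :=
  fderiv ℝ (fun v =>
    fderiv ℝ (fun v' => fderiv ℝ (d.b j x lam) v' (Pi.single rr 1)) v (Pi.single l 1))
    0 (Pi.single k 1)

/-- The characteristic `τ_j(ξ,x,t,λ,ω) = ω ∫_x^ξ dη / a_j(η,λ) + t`. -/
def tau (j : Fin n) (ξ x t lam ω : ℝ) : ℝ := ω * (∫ η in x..ξ, (d.a j η lam)⁻¹) + t

/-- The weight `c_j(ξ,x,λ) = exp ∫_x^ξ ∂_{u_j}b_j(η,λ,0) / a_j(η,λ) dη`. -/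
def cfac (j : Fin n) (ξ x lam : ℝ) : ℝ :=
  Real.exp (∫ η in x..ξ, d.dbu j j η lam / d.a j η lam)

/-- `f_j(x,λ,u) = ∂_{u_j}b_j(x,λ,0) u_j − b_j(x,λ,u)`. -/
def ffun (j : Fin n) (x lam : ℝ) (u : Fin n → ℝ) : ℝ := d.dbu j j x lam * u j - d.b j x lam u

/-- The operator `C(λ,ω)` acting on (representations of) functions. -/
def CopRaw (lam ω : ℝ) (U : ℝ → ℝ → Fin n → ℝ) (x t : ℝ) (j : Fin n) : ℝ :=
  if (j : ℕ) < m then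
    d.cfac j 0 x lam *
      ∑ k : Fin n, (if m ≤ (k : ℕ) then d.r j k * U 0 (d.tau j 0 x t lam ω) k else 0)
  else
    d.cfac j 1 x lam *
      ∑ k : Fin n, (if (k : ℕ) < m then d.r j k * U 1 (d.tau j 1 x t lam ω) k else 0)

/-- The operator `F(λ,ω,·)` acting on (representations of) functions. -/
def FopRaw (lam ω : ℝ) (U : ℝ → ℝ → Fin n → ℝ) (x t : ℝ) (j : Fin n) : ℝ :=
  ∫ ξ in (xjv m j)..x,
    (d.cfac j ξ x lam / d.a j ξ lam) * d.ffun j ξ lam (U ξ (d.tau j ξ x t lam ω))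

/-- The operator `D(λ,ω)`. -/
def DopRaw (lam ω : ℝ) (U : ℝ → ℝ → Fin n → ℝ) (x t : ℝ) (j : Fin n) : ℝ :=
  ∫ ξ in (xjv m j)..x,
    (d.cfac j ξ x lam / d.a j ξ lam) * U ξ (d.tau j ξ x t lam ω) j

/-- The Fréchet derivative `∂_u F(λ,ω,0)` (explicit formula). -/
def dFRaw (lam ω : ℝ) (U : ℝ → ℝ → Fin n → ℝ) (x t : ℝ) (j : Fin n) : ℝ :=
  -∫ ξ in (xjv m j)..x,
    (d.cfac j ξ x lam / d.a j ξ lam) *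
      ∑ k : Fin n, (if k ≠ j then d.dbu j k ξ lam * U ξ (d.tau j ξ x t lam ω) k else 0)

end HypData

/-- Partial derivative in `x` (within `[0,1]`). -/
def pdx {n : ℕ} (U : ℝ → ℝ → Fin n → ℝ) (x t : ℝ) (j : Fin n) : ℝ :=
  derivWithin (fun y => U y t j) (Set.Icc 0 1) x

/-- Partial derivative in `t`. -/
def pdt {n : ℕ} (U : ℝ → ℝ → Fin n → ℝ) (x t : ℝ) (j : Fin n) : ℝ :=
  deriv (fun s => U x s j) t

/-- `U` represents an element of `C_n`: continuous on `[0,1] × ℝ` and `2π`-periodic in time. -/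
def IsCnFun {n : ℕ} (U : ℝ → ℝ → Fin n → ℝ) : Prop :=
  ContinuousOn (fun p : ℝ × ℝ => U p.1 p.2) (Set.Icc 0 1 ×ˢ Set.univ) ∧
  ∀ x t, U x (t + 2 * Real.pi) = U x t

/-- `U` represents an element of `C_n^1`: it is in `C_n` and has continuous
partial derivatives `∂_x U`, `∂_t U` on `[0,1] × ℝ`. -/
def IsCn1Fun {n : ℕ} (U : ℝ → ℝ → Fin n → ℝ) : Prop :=
  IsCnFun U ∧
  (∀ (j : Fin n) (t : ℝ), ∀ x ∈ Set.Icc (0:ℝ) 1,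
      DifferentiableWithinAt ℝ (fun y => U y t j) (Set.Icc 0 1) x ∧
      DifferentiableAt ℝ (fun s => U x s j) t) ∧
  ContinuousOn (fun p : ℝ × ℝ => pdx U p.1 p.2) (Set.Icc 0 1 ×ˢ Set.univ) ∧
  ContinuousOn (fun p : ℝ × ℝ => pdt U p.1 p.2) (Set.Icc 0 1 ×ˢ Set.univ)

/-- The sup-norm `‖U‖_∞ = sup { |U_j(x,t)| : x ∈ [0,1], t ∈ ℝ, j }`. -/
def supNorm {n : ℕ} (U : ℝ → ℝ → Fin n → ℝ) : ℝ :=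
  sSup {y : ℝ | ∃ x ∈ Set.Icc (0:ℝ) 1, ∃ t : ℝ, ∃ j : Fin n, y = |U x t j|}

/-- The `C¹`-norm `‖U‖_∞ + ‖∂_x U‖_∞ + ‖∂_t U‖_∞`. -/
def c1Norm {n : ℕ} (U : ℝ → ℝ → Fin n → ℝ) : ℝ :=
  supNorm U + supNorm (pdx U) + supNorm (pdt U)

/-- The `L²`-type pairing `⟨u,v⟩ = (1/2π) Σ_j ∫_0^{2π} ∫_0^1 u_j v_j dx dt`. -/
def pairing {n : ℕ} (U V : ℝ → ℝ → Fin n → ℝ) : ℝ :=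
  (1 / (2 * Real.pi)) *
    ∑ j : Fin n, ∫ t in (0:ℝ)..(2 * Real.pi), ∫ x in (0:ℝ)..1, U x t j * V x t j

/-- The Hermitian pairing `⟨u,v⟩ = (1/2π) Σ_j ∫_0^{2π} ∫_0^1 u_j conj(v_j) dx dt`. -/
def pairingC {n : ℕ} (U : ℝ → ℝ → Fin n → ℝ) (V : ℝ → ℝ → Fin n → ℂ) : ℂ :=
  (1 / (2 * Real.pi) : ℂ) *
    ∑ j : Fin n, ∫ t in (0:ℝ)..(2 * Real.pi), ∫ x in (0:ℝ)..1,
      (U x t j : ℂ) * starRingEnd ℂ (V x t j)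

/-- The real part of the wave `v(x) e^{-it}`. -/
def reWave {n : ℕ} (v : Fin n → ℝ → ℂ) (x t : ℝ) (j : Fin n) : ℝ :=
  (v j x * Complex.exp (-(Complex.I * t))).re

/-- The imaginary part of the wave `v(x) e^{-it}`. -/
def imWave {n : ℕ} (v : Fin n → ℝ → ℂ) (x t : ℝ) (j : Fin n) : ℝ :=
  (v j x * Complex.exp (-(Complex.I * t))).im

/-- A family of complex functions on `[0,1]` is nontrivial. -/
def Nontriv {n : ℕ} (v : Fin n → ℝ → ℂ) : Prop := ∃ j : Fin n, ∃ x ∈ Set.Icc (0:ℝ) 1, v j x ≠ 0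

/-- The time shift operator `(S_φ u)(x,t) = u(x, t+φ)` on `Cspace n`. -/
def Sshift {n : ℕ} (φ : ℝ) (u : Cspace n) : Cspace n :=
  u.comp ⟨fun p => (p.1, p.2 + (φ : TimeCircle)), by continuity⟩

namespace HypData

variable {n m : ℕ} (d : HypData n m)

/-- The differential operator `A(λ,ω)`. -/
def AopRaw (lam ω : ℝ) (U : ℝ → ℝ → Fin n → ℝ) (x t : ℝ) (j : Fin n) : ℝ :=
  ω * pdt U x t j + d.a j x lam * pdx U x t j + d.dbu j j x lam * U x t j

/-- The formally adjoint differential operator `Ã(λ,ω)`. -/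
def AtilRaw (lam ω : ℝ) (U : ℝ → ℝ → Fin n → ℝ) (x t : ℝ) (j : Fin n) : ℝ :=
  -(ω * pdt U x t j) - derivWithin (fun y => d.a j y lam * U y t j) (Set.Icc 0 1) x +
    d.dbu j j x lam * U x t j

/-- The complex version of `Ã(λ,ω)` acting on complex-valued functions. -/
def AtilRawC (lam ω : ℝ) (W : ℝ → ℝ → Fin n → ℂ) (x t : ℝ) (j : Fin n) : ℂ :=
  -((ω : ℂ) * deriv (fun s => W x s j) t) -
    derivWithin (fun y => (d.a j y lam : ℂ) * W y t j) (Set.Icc 0 1) x +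
    (d.dbu j j x lam : ℂ) * W x t j

/-- The off-diagonal multiplication operator `B(λ)`. -/
def BopRaw (lam : ℝ) (U : ℝ → ℝ → Fin n → ℝ) (x t : ℝ) (j : Fin n) : ℝ :=
  ∑ k : Fin n, (if k ≠ j then d.dbu j k x lam * U x t k else 0)

/-- The reflection boundary conditions. -/
def SatBC (U : ℝ → ℝ → Fin n → ℝ) : Prop :=
  ∀ (t : ℝ) (j : Fin n),
    ((j : ℕ) < m → U 0 t j = ∑ k : Fin n, (if m ≤ (k : ℕ) then d.r j k * U 0 t k else 0)) ∧
    (m ≤ (j : ℕ) → U 1 t j = ∑ k : Fin n, (if (k : ℕ) < m then d.r j k * U 1 t k else 0))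

/-- The adjoint boundary conditions. -/
def SatAdjBC (lam : ℝ) (V : ℝ → ℝ → Fin n → ℝ) : Prop :=
  ∀ (t : ℝ) (j : Fin n),
    (m ≤ (j : ℕ) → d.a j 0 lam * V 0 t j
        = -∑ k : Fin n, (if (k : ℕ) < m then d.r k j * d.a k 0 lam * V 0 t k else 0)) ∧
    ((j : ℕ) < m → d.a j 1 lam * V 1 t j
        = -∑ k : Fin n, (if m ≤ (k : ℕ) then d.r k j * d.a k 1 lam * V 1 t k else 0))

/-- `U` is a classical (`C¹`, `2π`-time-periodic) solution of the hyperbolic system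
`ω ∂_t u_j + a_j(x,λ) ∂_x u_j + b_j(x,λ,u) = 0` with the reflection boundary conditions. -/
def IsClassicalSolution (lam ω : ℝ) (U : ℝ → ℝ → Fin n → ℝ) : Prop :=
  IsCn1Fun U ∧
  (∀ x ∈ Set.Ioo (0:ℝ) 1, ∀ (t : ℝ) (j : Fin n),
      ω * pdt U x t j + d.a j x lam * pdx U x t j + d.b j x lam (U x t) = 0) ∧
  d.SatBC U

/-- The standing assumptions: `1 ≤ m ≤ n`, smoothness of the coefficients, hyperbolicity
`a_j(x,0) ≠ 0`, nondegeneracy `a_j(x,0) ≠ a_k(x,0)` for `j ≠ k`, the trivial solution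
assumption `b_j(x,λ,0) = 0`, and nonvanishing of `a_j(x,λ)` for `|λ| ≤ δ₀`. -/
def StandingHyps (δ0 : ℝ) : Prop :=
  1 ≤ m ∧ m ≤ n ∧
  (∀ j, ContDiff ℝ (⊤ : ℕ∞) (fun p : ℝ × ℝ => d.a j p.1 p.2)) ∧
  (∀ j, ContDiff ℝ (⊤ : ℕ∞) (fun p : ℝ × ℝ × (Fin n → ℝ) => d.b j p.1 p.2.1 p.2.2)) ∧
  (∀ j, ∀ x ∈ Set.Icc (0:ℝ) 1, d.a j x 0 ≠ 0) ∧
  (∀ j k, j ≠ k → ∀ x ∈ Set.Icc (0:ℝ) 1, d.a j x 0 ≠ d.a k x 0) ∧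
  (∀ j x lam, d.b j x lam 0 = 0) ∧
  0 < δ0 ∧
  (∀ j, ∀ x ∈ Set.Icc (0:ℝ) 1, ∀ lam ∈ Set.Icc (-δ0) δ0, d.a j x lam ≠ 0)

/-- The constant `R₀(λ)`. -/
def R0lam (lam : ℝ) : ℝ :=
  sSup {y : ℝ | ∃ j : Fin n, (j : ℕ) < m ∧ ∃ x ∈ Set.Icc (0:ℝ) 1,
    y = ∑ k : Fin n, (if m ≤ (k : ℕ) then
          |d.r j k| * Real.exp (-∫ η in (0:ℝ)..x, d.dbu j j η lam / d.a j η lam) else 0)}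

/-- The constant `R₁(λ)`. -/
def R1lam (lam : ℝ) : ℝ :=
  sSup {y : ℝ | ∃ j : Fin n, m ≤ (j : ℕ) ∧ ∃ x ∈ Set.Icc (0:ℝ) 1,
    y = ∑ k : Fin n, (if (k : ℕ) < m then
          |d.r j k| * Real.exp (∫ η in x..(1:ℝ), d.dbu j j η lam / d.a j η lam) else 0)}

/-- `R₀ = R₀(0)`. -/
def R0c : ℝ := d.R0lam 0

/-- `R₁ = R₁(0)`. -/
def R1c : ℝ := d.R1lam 0

/-- `v` solves the eigenvalue problem (EV) with parameters `λ`, `μ`. -/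
def IsEV (lam : ℝ) (mu : ℂ) (v : Fin n → ℝ → ℂ) : Prop :=
  (∀ (j : Fin n), ∀ x ∈ Set.Icc (0:ℝ) 1, ∃ dv : ℂ,
      HasDerivWithinAt (v j) dv (Set.Icc 0 1) x ∧
      (d.a j x lam : ℂ) * dv + ∑ k : Fin n, (d.dbu j k x lam : ℂ) * v k x = mu * v j x) ∧
  (∀ j : Fin n, (j : ℕ) < m →
      v j 0 = ∑ k : Fin n, (if m ≤ (k : ℕ) then (d.r j k : ℂ) * v k 0 else 0)) ∧
  (∀ j : Fin n, m ≤ (j : ℕ) →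
      v j 1 = ∑ k : Fin n, (if (k : ℕ) < m then (d.r j k : ℂ) * v k 1 else 0))

/-- `w` solves the adjoint eigenvalue problem (AEV) with parameters `λ`, `ν`. -/
def IsAEV (lam : ℝ) (nu : ℂ) (w : Fin n → ℝ → ℂ) : Prop :=
  (∀ (j : Fin n), ∀ x ∈ Set.Icc (0:ℝ) 1, ∃ dw : ℂ,
      HasDerivWithinAt (fun y => (d.a j y lam : ℂ) * w j y) dw (Set.Icc 0 1) x ∧
      -dw + ∑ k : Fin n, (d.dbu k j x lam : ℂ) * w k x = nu * w j x) ∧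
  (∀ j : Fin n, m ≤ (j : ℕ) →
      (d.a j 0 lam : ℂ) * w j 0
        = -∑ k : Fin n, (if (k : ℕ) < m then (d.r k j : ℂ) * (d.a k 0 lam : ℂ) * w k 0 else 0)) ∧
  (∀ j : Fin n, (j : ℕ) < m →
      (d.a j 1 lam : ℂ) * w j 1
        = -∑ k : Fin n, (if m ≤ (k : ℕ) then (d.r k j : ℂ) * (d.a k 1 lam : ℂ) * w k 1 else 0))

/-- Assumption (H1): for `λ = 0`, `μ = i` the eigenvalue problem has exactly one
nontrivial solution up to linear dependence. -/
def HypH1 : Prop :=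
  ∃ v, d.IsEV 0 Complex.I v ∧ Nontriv v ∧
    ∀ v', d.IsEV 0 Complex.I v' → ∃ c : ℂ, ∀ (j : Fin n), ∀ x ∈ Set.Icc (0:ℝ) 1, v' j x = c * v j x

/-- Assumption (H2): algebraic simplicity. -/
def HypH2 : Prop :=
  ∀ v w, d.IsEV 0 Complex.I v → Nontriv v → d.IsAEV 0 (-Complex.I) w → Nontriv w →
    (∑ j : Fin n, ∫ x in (0:ℝ)..1, v j x * starRingEnd ℂ (w j x)) ≠ 0

/-- Assumption (H4): nonresonance. -/
def HypH4 : Prop :=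
  ∀ k : ℤ, (∃ v, d.IsEV 0 (Complex.I * k) v ∧ Nontriv v) → k = 1 ∨ k = -1

end HypData

/-- Normalization `Σ_j ∫_0^1 v⁰_j conj(w⁰_j) dx = 2`. -/
def NormalizedPair {n : ℕ} (v0 w0 : Fin n → ℝ → ℂ) : Prop :=
  (∑ j : Fin n, ∫ x in (0:ℝ)..1, v0 j x * starRingEnd ℂ (w0 j x)) = 2

/-- The transversality quantity `α`. -/
def alphaVal {n m : ℕ} (d : HypData n m) (v0 v0' w0 : Fin n → ℝ → ℂ) : ℝ :=
  (1/2) * (∑ j : Fin n, ∫ x in (0:ℝ)..1,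
    ((deriv (fun lam => d.a j x lam) 0 : ℂ) * v0' j x
      + ∑ k : Fin n, (deriv (fun lam => d.dbu j k x lam) 0 : ℂ) * v0 k x)
      * starRingEnd ℂ (w0 j x)).re

/-- The bifurcation-direction quantity `β`. -/
def betaVal {n m : ℕ} (d : HypData n m) (v0 w0 y z : Fin n → ℝ → ℂ) : ℝ :=
  -(∫ x in (0:ℝ)..1,
      ((1/8 : ℂ) * ∑ j : Fin n, ∑ k : Fin n, ∑ l : Fin n, ∑ rr : Fin n,
          (d.dbu3 j k l rr x 0 : ℂ) * v0 k x * v0 l x *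
            starRingEnd ℂ (v0 rr x) * starRingEnd ℂ (w0 j x)
        + ∑ j : Fin n, ∑ k : Fin n, ∑ l : Fin n,
          (d.dbu2 j k l x 0 : ℂ) * (y k x * starRingEnd ℂ (v0 l x) + z k x * v0 l x) *
            starRingEnd ℂ (w0 j x))).re

end

section RieszTheory

variable {X : Type*} [NormedAddCommGroup X] [NormedSpace ℝ X]

theorem exists_norm_one_half_le_norm_sub {V W : Submodule ℝ X} (hW : IsClosed (W : Set X))
    (hWV : W < V) : ∃ x ∈ V, ‖x‖ = 1 ∧ ∀ y ∈ W, 1 / 2 ≤ ‖x - y‖ := by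
  have h₁ : IsClosed ((W.comap V.subtype : Submodule ℝ V) : Set V) :=
    hW.preimage continuous_subtype_val
  obtain ⟨v, hv, hvW⟩ := SetLike.exists_of_lt hWV
  obtain ⟨x, -, hx, hxy⟩ := riesz_lemma_of_lt_one (𝕜 := ℝ) (r := 1 / 2) h₁ ⟨⟨v, hv⟩, hvW⟩
    (by norm_num)
  exact ⟨x, x.2, hx, fun y hy => hxy ⟨y, hWV.le hy⟩ hy⟩

theorem IsCompactOperator.not_separated {K : X →L[ℝ] X} (hK : IsCompactOperator K)
    {f : ℕ → X} (hf : ∀ n, ‖f n‖ = 1) : ¬ ∀ m n, m < n → 1 / 2 ≤ ‖K (f n) - K (f m)‖ := by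
  intro hsep
  obtain ⟨S, hS, hS'⟩ := hK.image_closedBall_subset_compact 1
  obtain ⟨y, -, ψ, hψ, hψy⟩ := hS.tendsto_subseq (fun n ↦ hS' ⟨f n, by simp [hf], rfl⟩)
  obtain ⟨N, hN⟩ := Metric.cauchySeq_iff'.1 hψy.cauchySeq (1 / 2) (by norm_num)
  have h := hN (N + 1) (by simp)
  rw [dist_eq_norm] at h
  exact (hsep _ _ (hψ (Nat.lt_succ_self N))).not_gt h

theorem exists_pos_mul_norm_le_norm_sub {K : X →L[ℝ] X} (hK : IsCompactOperator (K ∘L K))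
    (hinj : ∀ x, K x = x → x = 0) : ∃ c > 0, ∀ x, c * ‖x‖ ≤ ‖x - K x‖ := by
  by_contra! h
  have h' : ∀ n : ℕ, ∃ x, ‖x‖ = 1 ∧ ‖x - K x‖ < 1 / ((n : ℝ) + 1) := by
    intro n
    obtain ⟨x, hx⟩ := h (1 / ((n : ℝ) + 1)) (by positivity)
    have hx0 : 0 < ‖x‖ := by
      refine norm_pos_iff.2 fun h0 => ?_
      simp [h0] at hx
    refine ⟨‖x‖⁻¹ • x, by simp [norm_smul, hx0.ne'], ?_⟩
    rw [map_smul, ← smul_sub, norm_smul, norm_inv, norm_norm, inv_mul_lt_iff₀ hx0, mul_comm]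
    exact hx
  choose x hx1 hx2 using h'
  have hlim : Tendsto (fun n => x n - K (x n)) atTop (𝓝 0) :=
    squeeze_zero_norm (fun n => (hx2 n).le) tendsto_one_div_add_atTop_nhds_zero_nat
  obtain ⟨S, hS, hS'⟩ := hK.image_closedBall_subset_compact 1
  obtain ⟨y, -, ψ, hψ, hψy⟩ := hS.tendsto_subseq (fun n ↦ hS' ⟨x n, by simp [hx1], rfl⟩)
  have hlim2 : Tendsto (fun n => x n - K (K (x n))) atTop (𝓝 0) := by
    have := hlim.add ((K.continuous.tendsto 0).comp hlim)
    simpa [Function.comp_def] using this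
  have hxy : Tendsto (fun n => x (ψ n)) atTop (𝓝 y) := by
    have := (hlim2.comp hψ.tendsto_atTop).add hψy
    simpa [Function.comp_def] using this
  have hy : y - K y = 0 := tendsto_nhds_unique
    (hxy.sub ((K.continuous.tendsto y).comp hxy)) (hlim.comp hψ.tendsto_atTop)
  have hy1 : ‖y‖ = 1 := tendsto_nhds_unique hxy.norm (by simp [hx1])
  have := hinj y (sub_eq_zero.1 hy).symm
  simp [this] at hy1

theorem surjective_sub_of_injective [CompleteSpace X] {K : X →L[ℝ] X}
    (hK : IsCompactOperator (K ∘L K)) (hinj : ∀ x, K x = x → x = 0) (y : X) :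
    ∃ x, x - K x = y := by
  by_contra hy
  obtain ⟨c, hc, hbd⟩ := exists_pos_mul_norm_le_norm_sub hK hinj
  let T : X →L[ℝ] X := ContinuousLinearMap.id ℝ X - K
  have hT : ∀ x, T x = x - K x := fun x => rfl
  have hTemb : IsClosedEmbedding T := by
    refine (AntilipschitzWith.isClosedEmbedding (K := Real.toNNReal c⁻¹) ?_ T.uniformContinuous)
    refine AddMonoidHomClass.antilipschitz_of_bound T fun x => ?_
    have := hbd x
    rw [← hT] at this
    rw [Real.coe_toNNReal _ (by positivity)]
    rwa [← div_eq_inv_mul, le_div_iff₀ hc, mul_comm]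
  let V : ℕ → Submodule ℝ X := fun n => ((T : X →ₗ[ℝ] X) ^ n).range
  have hVs : ∀ n, V (n + 1) = (V n).map (T : X →ₗ[ℝ] X) := fun n => by
    simp only [V, pow_succ', Module.End.mul_eq_comp, LinearMap.range_comp]
  have hVc : ∀ n, IsClosed (V n : Set X) := by
    intro n
    induction n with
    | zero => simp [V, Module.End.one_eq_id]
    | succ n ih =>
      rw [hVs]
      exact hTemb.isClosedMap _ ih
  have hle : ∀ n, V (n + 1) ≤ V n := by
    rintro n _ ⟨x, rfl⟩
    exact ⟨T x, by rw [pow_succ]; rfl⟩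
  have hanti : Antitone V := antitone_nat_of_succ_le hle
  have hinjT : Function.Injective T := hTemb.injective
  have hlt : ∀ n, V (n + 1) < V n := by
    intro n
    refine lt_of_le_of_ne (hle n) fun heq => ?_
    have h1 : ((T : X →ₗ[ℝ] X) ^ n) y ∈ V (n + 1) := heq ▸ ⟨y, rfl⟩
    obtain ⟨x, hx⟩ := h1
    rw [pow_succ] at hx
    have hinjn : Function.Injective ((T : X →ₗ[ℝ] X) ^ n) := by
      rw [Module.End.coe_pow]; exact hinjT.iterate n
    exact hy ⟨x, hinjn hx⟩
  choose x hxV hx1 hxd using fun n => exists_norm_one_half_le_norm_sub (hVc (n + 1)) (hlt n)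
  have hTm : ∀ n, ∀ z ∈ V n, T z ∈ V (n + 1) := fun n z hz => by
    rw [hVs]; exact ⟨z, hz, rfl⟩
  refine hK.not_separated hx1 fun m n hmn => ?_
  rw [norm_sub_rev]
  have hKm : ∀ z ∈ V (m + 1), K z ∈ V (m + 1) := fun z hz => by
    have : K z = z - T z := by simp [hT]
    rw [this]
    exact sub_mem hz (hle _ (hTm _ _ hz))
  have hxn : x n ∈ V (m + 1) := hanti hmn (hxV n)
  have h1 : T (x m) ∈ V (m + 1) := hTm _ _ (hxV m)
  have key := hxd m ((2 : ℝ) • T (x m) - T (T (x m)) + K (K (x n)))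
    (add_mem (sub_mem (Submodule.smul_mem _ _ h1) (hle _ (hTm _ _ h1))) (hKm _ (hKm _ hxn)))
  refine key.trans_eq (congrArg _ ?_)
  simp only [hT, map_sub, ContinuousLinearMap.comp_apply, smul_sub, two_smul]
  abel

theorem injective_sub_of_surjective {K : X →L[ℝ] X}
    (hK : IsCompactOperator (K ∘L K)) (hsurj : ∀ y, ∃ x, x - K x = y) (z : X) (hz : K z = z) :
    z = 0 := by
  by_contra hz0
  let T : X →L[ℝ] X := ContinuousLinearMap.id ℝ X - K
  have hT : ∀ x, T x = x - K x := fun x => rfl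
  have hTs : Function.Surjective T := hsurj
  let V : ℕ → Submodule ℝ X := fun n => ((T : X →ₗ[ℝ] X) ^ n).ker
  have hmem : ∀ n x, x ∈ V n ↔ (T^[n]) x = 0 := fun n x => by
    simp only [V, LinearMap.mem_ker, Module.End.coe_pow]; rfl
  have hVc : ∀ n, IsClosed (V n : Set X) := by
    intro n
    have : (V n : Set X) = (T^[n]) ⁻¹' {0} := by ext x; exact hmem n x
    rw [this]
    exact isClosed_singleton.preimage (T.continuous.iterate n)
  have hTm : ∀ n, ∀ z ∈ V (n + 1), T z ∈ V n := fun n z hz => by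
    rw [hmem] at hz ⊢
    rwa [Function.iterate_succ_apply] at hz
  have hle : ∀ n, V n ≤ V (n + 1) := by
    intro n x hx
    rw [hmem] at hx ⊢
    rw [Function.iterate_succ_apply', hx, map_zero]
  have hmono : Monotone V := monotone_nat_of_le_succ hle
  have hlt : ∀ n, V n < V (n + 1) := by
    intro n
    refine lt_of_le_of_ne (hle n) fun heq => ?_
    obtain ⟨y, hy⟩ := hTs.iterate n z
    have h1 : y ∈ V (n + 1) := by
      rw [hmem, Function.iterate_succ_apply', hy, hT, hz, sub_self]
    rw [← heq, hmem, hy] at h1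
    exact hz0 h1
  choose x hxV hx1 hxd using fun n => exists_norm_one_half_le_norm_sub (hVc n) (hlt n)
  refine hK.not_separated hx1 fun m n hmn => ?_
  have hKm : ∀ z ∈ V n, K z ∈ V n := fun z hz => by
    have : K z = z - T z := by simp [hT]
    rw [this]
    exact sub_mem hz (hTm _ _ (hle _ hz))
  have hxm : x m ∈ V n := hmono hmn (hxV m)
  have h1 : T (x n) ∈ V n := hTm _ _ (hxV n)
  have key := hxd n ((2 : ℝ) • T (x n) - T (T (x n)) + K (K (x m)))
    (add_mem (sub_mem (Submodule.smul_mem _ _ h1) (hTm _ _ (hle _ h1))) (hKm _ (hKm _ hxm)))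
  refine key.trans_eq (congrArg _ ?_)
  simp only [hT, map_sub, ContinuousLinearMap.comp_apply, smul_sub, two_smul]
  abel


theorem isCompactOperator_comp_self_of_parametrix {R D E : X →L[ℝ] X}
    (hD : IsCompactOperator (D ∘L R ∘L D)) (hE : IsCompactOperator E) :
    IsCompactOperator ((R ∘L (D - E)) ∘L (R ∘L (D - E))) := by
  have h1 := hD.clm_comp R
  have h2 := (hE.clm_comp R).clm_comp (R ∘L D)
  have h3 := (hE.comp_clm (R ∘L (D - E))).clm_comp R
  refine (congrArg IsCompactOperator (funext fun x => ?_)).mp ((h1.sub h2).sub h3)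
  simp only [ContinuousLinearMap.comp_apply, sub_apply, map_sub,
    Function.comp_apply, Pi.sub_apply]
  abel

theorem surjective_of_injective_of_parametrix [CompleteSpace X] {B R D E : X →L[ℝ] X}
    (hBR : ∀ x, B (R x) = x)
    (hD : IsCompactOperator (D ∘L R ∘L D)) (hE : IsCompactOperator E)
    (hinj : ∀ x, B x - D x + E x = 0 → x = 0) (y : X) : ∃ x, B x - D x + E x = y := by
  obtain ⟨x, hx⟩ := surjective_sub_of_injective (isCompactOperator_comp_self_of_parametrix hD hE)
    (fun x hx => hinj x (by
      have := congrArg B hx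
      simp only [ContinuousLinearMap.comp_apply, sub_apply, hBR] at this
      rw [← this]; abel)) (R y)
  refine ⟨x, ?_⟩
  have := congrArg B hx
  simp only [ContinuousLinearMap.comp_apply, sub_apply, hBR, map_sub] at this
  rw [← this]; abel

theorem injective_of_surjective_of_parametrix {B R D E : X →L[ℝ] X}
    (hRB : ∀ x, R (B x) = x)
    (hD : IsCompactOperator (D ∘L R ∘L D)) (hE : IsCompactOperator E)
    (hsurj : ∀ y, ∃ x, B x - D x + E x = y) (x : X) (hx : B x - D x + E x = 0) : x = 0 := by
  refine injective_sub_of_surjective (isCompactOperator_comp_self_of_parametrix hD hE)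
    (fun y => ?_) x ?_
  · obtain ⟨x, hx⟩ := hsurj (B y)
    refine ⟨x, ?_⟩
    have := congrArg R hx
    simp only [map_add, map_sub, hRB] at this
    simp only [ContinuousLinearMap.comp_apply, sub_apply, map_sub]
    rw [← this]; abel
  · have := congrArg R hx
    simp only [map_add, map_sub, hRB, map_zero] at this
    simp only [ContinuousLinearMap.comp_apply, sub_apply, map_sub]
    rw [← sub_eq_zero, ← neg_eq_zero, ← this]; abel

theorem finiteDimensional_ker_of_parametrix [CompleteSpace X] {B R D : X →L[ℝ] X}
    (hRB : ∀ x, R (B x) = x) (hD : IsCompactOperator (D ∘L R ∘L D)) :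
    FiniteDimensional ℝ (LinearMap.ker (B - D).toLinearMap) := by
  set V := LinearMap.ker (B - D).toLinearMap
  have hVc : IsClosed (V : Set X) := (B - D).isClosed_ker
  have hfix : ∀ v ∈ V, R (D v) = v := fun v hv => by
    have : B v - D v = 0 := hv
    rw [← sub_eq_zero.1 this, hRB]
  have hcomp : IsCompactOperator ((R ∘L (D ∘L R ∘L D) : X →L[ℝ] X) : X →ₗ[ℝ] X) :=
    hD.clm_comp R
  have hid : ∀ v ∈ V, ((R ∘L (D ∘L R ∘L D) : X →L[ℝ] X) : X →ₗ[ℝ] X) v = v := fun v hv => by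
    change R (D (R (D v))) = v
    rw [hfix v hv, hfix v hv]
  have := hcomp.restrict (V := V) (fun v hv => by rw [hid v hv]; exact hv) hVc
  have heq : ((((R ∘L (D ∘L R ∘L D) : X →L[ℝ] X) : X →ₗ[ℝ] X).restrict
      (fun v hv => by rw [hid v hv]; exact hv) : V →ₗ[ℝ] V) : V → V) = id :=
    funext fun v => Subtype.ext (hid v v.2)
  exact FiniteDimensional.of_isCompactOperator_id (𝕜 := ℝ) (E := V) (heq ▸ this)

theorem apply_eq_self_of_mem_range {P : X →L[ℝ] X} (hP : P ∘L P = P) {x : X}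
    (hx : x ∈ LinearMap.range P.toLinearMap) : P x = x := by
  obtain ⟨y, rfl⟩ := hx
  exact congrArg (fun T : X →L[ℝ] X => T y) hP

/-- A compact perturbation of the invertible operator `B₀` has index zero: the ranges of a
projection along the range and of a projection onto the kernel are isomorphic. -/
theorem exists_equiv_range_of_parametrix [CompleteSpace X] {B R D P Q : X →L[ℝ] X}
    (hRB : ∀ x, R (B x) = x) (hBR : ∀ x, B (R x) = x)
    (hD : IsCompactOperator (D ∘L R ∘L D))
    (hP : P ∘L P = P) (hQ : Q ∘L Q = Q)
    (hPker : LinearMap.ker P.toLinearMap = LinearMap.range (B - D).toLinearMap)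
    (hQrange : LinearMap.range Q.toLinearMap = LinearMap.ker (B - D).toLinearMap) :
    FiniteDimensional ℝ (LinearMap.range P.toLinearMap) ∧
      ∃ J : X →L[ℝ] X, IsCompactOperator J ∧ (∀ x, P (J x) = J x) ∧
        ∀ x, J x = 0 → Q x = 0 := by
  set Vp := LinearMap.range P.toLinearMap
  set Vq := LinearMap.range Q.toLinearMap
  have hQfix : ∀ x ∈ Vq, Q x = x := fun x hx => apply_eq_self_of_mem_range hQ hx
  have hPfix : ∀ x ∈ Vp, P x = x := fun x hx => apply_eq_self_of_mem_range hP hx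
  have hfin : FiniteDimensional ℝ Vq := by
    rw [hQrange]; exact finiteDimensional_ker_of_parametrix hRB hD
  let q : X →L[ℝ] Vq := Q.codRestrict Vq (fun x => ⟨x, rfl⟩)
  have hq : ∀ x, ((q x : Vq) : X) = Q x := fun x => rfl
  have hqfix : ∀ v : Vq, q v = v := fun v => Subtype.ext (hQfix v v.2)
  have hPL : ∀ x, P (B x - D x) = 0 := fun x => by
    have : B x - D x ∈ LinearMap.ker P.toLinearMap := hPker ▸ ⟨x, rfl⟩
    exact this
  have hLker : ∀ x, B x - D x = 0 → x ∈ Vq := fun x hx => by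
    rw [hQrange]; exact hx
  have hkerL : ∀ x ∈ Vq, B x - D x = 0 := fun x hx => by
    rw [hQrange] at hx; exact hx
  have hLQ : ∀ x, B (Q x) - D (Q x) = 0 := fun x => hkerL _ ⟨x, rfl⟩
  let ext (J : Vq →ₗ[ℝ] Vp) : X →L[ℝ] X := Vp.subtypeL ∘L (LinearMap.toContinuousLinearMap J) ∘L q
  have hext : ∀ (J : Vq →ₗ[ℝ] Vp) x, ext J x = (J (q x) : X) := fun J x => rfl
  have hextc : ∀ J, IsCompactOperator (ext J) := fun J =>
    (isCompactOperator_of_locallyCompactSpace_dom q).clm_comp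
      (Vp.subtypeL ∘L (LinearMap.toContinuousLinearMap J))
  suffices h : ∃ J : Vq →ₗ[ℝ] Vp, Function.Injective J ∧ Function.Surjective J by
    obtain ⟨J, hJi, hJs⟩ := h
    refine ⟨Module.Finite.of_surjective J hJs, ext J, hextc J, fun x => ?_, fun x hx => ?_⟩
    · exact hPfix _ (J (q x)).2
    · have h0 : J (q x) = 0 := Subtype.ext hx
      have h1 : q x = 0 := hJi (by rw [h0, map_zero])
      rw [← hq, h1]; rfl
  rcases le_total (Module.rank ℝ Vq) (Module.rank ℝ Vp) with hle | hle
  · obtain ⟨J, hJ⟩ := rank_le_iff_exists_linearMap.1 hle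
    refine ⟨J, hJ, fun v => ?_⟩
    obtain ⟨x, hx⟩ := surjective_of_injective_of_parametrix hBR hD (hextc J) (fun x hx => by
      have hJx : ext J x = 0 := by
        have := congrArg P hx
        rwa [map_add, hPL, zero_add, map_zero, hext, hPfix _ (J (q x)).2, ← hext] at this
      rw [hJx, add_zero] at hx
      have hJ0 : J (q x) = 0 := Subtype.ext hJx
      have hq0 : q x = 0 := hJ (by rw [hJ0, map_zero])
      rw [← hQfix x (hLker x hx), ← hq, hq0]; rfl) (v : X)
    refine ⟨q x, Subtype.ext ?_⟩
    have := congrArg P hx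
    rwa [map_add, hPL, zero_add, hext, hPfix _ (J (q x)).2, hPfix _ v.2] at this
  · obtain ⟨i, hi⟩ := rank_le_iff_exists_linearMap.1 hle
    obtain ⟨J, hJ⟩ := i.exists_leftInverse_of_injective (LinearMap.ker_eq_bot.2 hi)
    have hJi : ∀ v, J (i v) = v := fun v => LinearMap.congr_fun hJ v
    refine ⟨J, ?_, fun v => ⟨i v, hJi v⟩⟩
    have hinj := injective_of_surjective_of_parametrix hRB hD (hextc J) (fun y => by
      obtain ⟨x, hx⟩ : y - P y ∈ LinearMap.range (B - D).toLinearMap := by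
        rw [← hPker]
        change P (y - P y) = 0
        rw [map_sub, hPfix (P y) ⟨y, rfl⟩, sub_self]
      replace hx : B x - D x = y - P y := hx
      let v : Vq := i ⟨P y, ⟨y, rfl⟩⟩
      refine ⟨x - Q x + v, ?_⟩
      have h1 : q (x - Q x + v) = v := by
        rw [map_add, hqfix, map_sub]
        have : q (Q x) = q x := hqfix (q x)
        rw [this, sub_self, zero_add]
      have h2 : B v - D v = 0 := hkerL v v.2
      rw [hext, h1, hJi]
      have h3 := hLQ x
      simp only [map_add, map_sub]
      calc B x - B (Q x) + B v - (D x - D (Q x) + D v) + P y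
          = (B x - D x) - (B (Q x) - D (Q x)) + (B v - D v) + P y := by abel
        _ = y := by rw [hx, h2, h3]; abel)
    refine (injective_iff_map_eq_zero J).2 fun v hv => ?_
    refine Subtype.ext (hinj v ?_)
    rw [hkerL v v.2, hext, hqfix, hv, zero_add]; rfl

/-- Surjectivity of the reduced linearization near a parameter at which the index is zero. -/
theorem exists_preimage_of_lower_bound [CompleteSpace X] {B₀ R₀ D₀ B R D P Q : X →L[ℝ] X}
    (hRB₀ : ∀ x, R₀ (B₀ x) = x) (hBR₀ : ∀ x, B₀ (R₀ x) = x)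
    (hD₀ : IsCompactOperator (D₀ ∘L R₀ ∘L D₀))
    (hBR : ∀ x, B (R x) = x)
    (hD : IsCompactOperator (D ∘L R ∘L D))
    (hP : P ∘L P = P) (hQ : Q ∘L Q = Q)
    (hPker : LinearMap.ker P.toLinearMap = LinearMap.range (B₀ - D₀).toLinearMap)
    (hQrange : LinearMap.range Q.toLinearMap = LinearMap.ker (B₀ - D₀).toLinearMap)
    (hinj : ∀ w, Q w = 0 → (B w - D w) - P (B w - D w) = 0 → w = 0) (y : X) (hy : P y = 0) :
    ∃ w, Q w = 0 ∧ (B w - D w) - P (B w - D w) = y := by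
  obtain ⟨hfin, J, hJc, hJP, hJQ⟩ := exists_equiv_range_of_parametrix hRB₀ hBR₀ hD₀ hP hQ hPker
    hQrange
  have hPP : ∀ x, P (P x) = P x := fun x => apply_eq_self_of_mem_range hP ⟨x, rfl⟩
  have hPc : IsCompactOperator P := by
    let p : X →L[ℝ] LinearMap.range P.toLinearMap := P.codRestrict _ (fun x => ⟨x, rfl⟩)
    exact (isCompactOperator_of_locallyCompactSpace_dom p).clm_comp
      (LinearMap.range P.toLinearMap).subtypeL
  have hE : IsCompactOperator (J - P ∘L (B - D)) := hJc.sub (hPc.comp_clm (B - D))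
  have hsplit : ∀ x z, P z = 0 → B x - D x + (J - P ∘L (B - D)) x = z →
      Q x = 0 ∧ (B x - D x) - P (B x - D x) = z := by
    intro x z hz h
    have h' : (B x - D x) - P (B x - D x) + J x = z := by
      rw [← h]
      simp only [sub_apply, ContinuousLinearMap.comp_apply]
      abel
    have hJ0 : J x = 0 := by
      have := congrArg P h'
      rwa [map_add, map_sub P (B x - D x), hPP, sub_self, zero_add, hJP, hz] at this
    exact ⟨hJQ x hJ0, by rwa [hJ0, add_zero] at h'⟩
  obtain ⟨x, hx⟩ := surjective_of_injective_of_parametrix hBR hD hE (fun x hx => by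
    obtain ⟨h1, h2⟩ := hsplit x 0 (map_zero P) hx
    exact hinj x h1 h2) y
  exact ⟨x, hsplit x y hy hx⟩

end RieszTheory

section LiapunovSchmidt

variable {X : Type*} [NormedAddCommGroup X] [NormedSpace ℝ X]

theorem eventually_norm_le_mul_of_finiteDimensional {Λ : Type*} {l : Filter Λ}
    {S : Λ → X →L[ℝ] X} (V : Submodule ℝ X) [FiniteDimensional ℝ V]
    (hS : ∀ v ∈ V, Tendsto (fun p => S p v) l (𝓝 0)) {ε : ℝ} (hε : 0 < ε) :
    ∀ᶠ p in l, ∀ v ∈ V, ‖S p v‖ ≤ ε * ‖v‖ := by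
  let e := Module.finBasis ℝ V
  obtain ⟨K, hK, hKb⟩ := e.exists_opNorm_le (F := X)
  have h : ∀ᶠ p in l, ∀ i, ‖S p (e i)‖ ≤ ε / K := eventually_all.2 fun i =>
    ((hS _ (e i).2).norm.eventually_lt_const (by simpa using div_pos hε hK)).mono
      fun p hp => hp.le
  filter_upwards [h] with p hp v hv
  have h1 := hKb (u := S p ∘L V.subtypeL) (M := ε / K) (by positivity) hp
  have h2 := (S p ∘L V.subtypeL).le_of_opNorm_le h1 ⟨v, hv⟩
  rw [mul_div_cancel₀ _ hK.ne'] at h2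
  exact h2

/-- Solvability of a small Lipschitz perturbation of a linear equation on `ker Q`. -/
theorem existsUnique_ker_of_lower_bound [CompleteSpace X] {S P Q D : X →L[ℝ] X} {F : X → X}
    {c ε δ : ℝ} (hc : 0 < c) (hδ : 0 ≤ δ) (hε0 : 0 ≤ ε)
    (hε : 4 * (‖ContinuousLinearMap.id ℝ X - P‖ * ε) ≤ c)
    (hbd : ∀ w, Q w = 0 → c * ‖w‖ ≤ ‖S w - P (S w)‖)
    (hsurj : ∀ y, ∃ w, Q w = 0 ∧ S w - P (S w) = y - P y)
    (hF0 : F 0 = 0) (hF : ∀ x y, ‖x‖ ≤ 2 * δ → ‖y‖ ≤ 2 * δ →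
      ‖F x - F y - (D x - D y)‖ ≤ ε * ‖x - y‖)
    {v : X} (hv : ‖v‖ ≤ δ) (hSv : ‖S v‖ ≤ ε * ‖v‖) :
    ∃! w, Q w = 0 ∧ ‖w‖ ≤ δ ∧
      (S (v + w) + D (v + w) - F (v + w)) - P (S (v + w) + D (v + w) - F (v + w)) = 0 := by
  set M := ‖ContinuousLinearMap.id ℝ X - P‖
  have hM : ∀ x, ‖x - P x‖ ≤ M * ‖x‖ := (ContinuousLinearMap.id ℝ X - P).le_opNorm
  have hM0 : 0 ≤ M := norm_nonneg _
  have hsmall : ∀ w, ‖w‖ ≤ δ → ‖v + w‖ ≤ 2 * δ := fun w hw => by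
    linarith [norm_add_le v w]
  choose f hfQ hf using fun w => hsurj (F (v + w) - D (v + w) - S v)
  have hdist : ∀ w w', ‖w‖ ≤ δ → ‖w'‖ ≤ δ → c * ‖f w - f w'‖ ≤ M * ε * ‖w - w'‖ := by
    intro w w' hw hw'
    refine (hbd _ (by rw [map_sub, hfQ, hfQ, sub_zero])).trans ?_
    have h1 : S (f w - f w') - P (S (f w - f w')) =
        (F (v + w) - F (v + w') - (D (v + w) - D (v + w'))) -
          P (F (v + w) - F (v + w') - (D (v + w) - D (v + w'))) := by
      have h2 := hf w
      have h3 := hf w'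
      rw [map_sub S, map_sub P, sub_sub_sub_comm, h2, h3]
      simp only [map_sub]
      abel
    rw [h1, mul_assoc]
    refine (hM _).trans (mul_le_mul_of_nonneg_left ?_ hM0)
    refine (hF _ _ (hsmall w hw) (hsmall w' hw')).trans_eq ?_
    rw [add_sub_add_left_eq_sub]
  have hself : ∀ w, ‖w‖ ≤ δ → ‖f w‖ ≤ δ := by
    intro w hw
    have h1 : c * ‖f w‖ ≤ M * (3 * (ε * δ)) := by
      refine (hbd _ (hfQ w)).trans ?_
      rw [hf]
      refine (hM _).trans (mul_le_mul_of_nonneg_left ?_ hM0)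
      refine (norm_sub_le _ _).trans ?_
      have h2 := hF (v + w) 0 (hsmall w hw) (by simpa using hδ)
      rw [hF0, map_zero, sub_zero, sub_zero, sub_zero] at h2
      nlinarith [hsmall w hw]
    nlinarith
  have hiff : ∀ w, (S (v + w) + D (v + w) - F (v + w)) - P (S (v + w) + D (v + w) - F (v + w))
      = (S w - P (S w)) - (S (f w) - P (S (f w))) := fun w => by
    rw [hf]
    simp only [map_add, map_sub]
    abel
  have hcomp : IsComplete {w | Q w = 0 ∧ ‖w‖ ≤ δ} := by
    refine IsClosed.isComplete ?_
    exact (isClosed_eq Q.continuous continuous_const).inter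
      (isClosed_le continuous_norm continuous_const)
  have hmaps : MapsTo f {w | Q w = 0 ∧ ‖w‖ ≤ δ} {w | Q w = 0 ∧ ‖w‖ ≤ δ} :=
    fun w hw => ⟨hfQ w, hself w hw.2⟩
  have hcontr : ∀ w w', ‖w‖ ≤ δ → ‖w'‖ ≤ δ → ‖f w - f w'‖ ≤ 1 / 2 * ‖w - w'‖ := by
    intro w w' hw hw'
    have h1 := hdist w w' hw hw'
    have h2 : 0 ≤ ‖w - w'‖ := norm_nonneg _
    by_contra! h3
    nlinarith
  have hK : ContractingWith (1 / 2) (hmaps.restrict f _ _) := by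
    refine ⟨by norm_num, LipschitzWith.of_dist_le_mul fun w w' => ?_⟩
    rw [Subtype.dist_eq, Subtype.dist_eq, dist_eq_norm, dist_eq_norm]
    simpa using hcontr w w' w.2.2 w'.2.2
  obtain ⟨w, ⟨hwQ, hwδ⟩, hfw, -⟩ := hK.exists_fixedPoint' hcomp hmaps (x := 0)
    (by simpa using hδ) (edist_ne_top _ _)
  refine ⟨w, ⟨hwQ, hwδ, ?_⟩, ?_⟩
  · rw [hiff, hfw, sub_self]
  · rintro w' ⟨hwQ', hwδ', hw'⟩
    replace hw' : S (w' - f w') - P (S (w' - f w')) = 0 := by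
      rw [← hw', hiff]
      simp only [map_sub]
      abel
    have h1 : w' = f w' := by
      have h2 := hbd (w' - f w') (by rw [map_sub, hfQ, hwQ', sub_zero])
      rw [hw', norm_zero] at h2
      have h3 : ‖w' - f w'‖ ≤ 0 := by
        by_contra! h4
        nlinarith
      exact sub_eq_zero.1 (norm_le_zero_iff.1 h3)
    have h5 := hcontr w' w hwδ' hwδ
    rw [← h1, hfw] at h5
    exact sub_eq_zero.1 (norm_le_zero_iff.1 (by linarith [norm_nonneg (w' - w)]))

/-- Local unique solvability of the infinite-dimensional part of a Liapunov–Schmidt system whose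
linear part depends only strongly continuously on the parameter. -/
theorem eventually_existsUnique_ker [CompleteSpace X] {Λ : Type*} [TopologicalSpace Λ] {p₀ : Λ}
    {C D R : Λ → X →L[ℝ] X} {F : Λ → X → X} {P Q : X →L[ℝ] X} {c : ℝ} (hc : 0 < c)
    (hR : ∀ᶠ p in 𝓝 p₀, (∀ x, R p (x - C p x) = x) ∧ (∀ x, R p x - C p (R p x) = x) ∧
      IsCompactOperator (D p ∘L R p ∘L D p))
    (hcont : ∀ u, Tendsto (fun p => u - C p u - D p u) (𝓝 p₀) (𝓝 (u - C p₀ u - D p₀ u)))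
    (hF0 : ∀ᶠ p in 𝓝 p₀, F p 0 = 0)
    (hF : ∀ ε > 0, ∃ ρ > 0, ∀ᶠ p in 𝓝 p₀, ∀ x y, ‖x‖ ≤ ρ → ‖y‖ ≤ ρ →
      ‖F p x - F p y - (D p x - D p y)‖ ≤ ε * ‖x - y‖)
    (hP : P ∘L P = P) (hQ : Q ∘L Q = Q)
    (hPker : LinearMap.ker P.toLinearMap =
      LinearMap.range (ContinuousLinearMap.id ℝ X - C p₀ - D p₀).toLinearMap)
    (hQrange : LinearMap.range Q.toLinearMap =
      LinearMap.ker (ContinuousLinearMap.id ℝ X - C p₀ - D p₀).toLinearMap)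
    (hbd : ∀ᶠ p in 𝓝 p₀, ∀ w, Q w = 0 →
      c * ‖w‖ ≤ ‖(w - C p w - D p w) - P (w - C p w - D p w)‖) :
    ∃ ρ > 0, ∀ᶠ p in 𝓝 p₀, ∀ δ, 0 < δ → δ ≤ ρ → ∀ v ∈ LinearMap.range Q.toLinearMap, ‖v‖ ≤ δ →
      ∃! w, Q w = 0 ∧ ‖w‖ ≤ δ ∧
        ((v + w) - C p (v + w) - F p (v + w)) - P ((v + w) - C p (v + w) - F p (v + w)) = 0 := by
  set M := ‖ContinuousLinearMap.id ℝ X - P‖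
  have hM0 : 0 ≤ M := norm_nonneg _
  have hε : 0 < c / (4 * (M + 1)) := by positivity
  obtain ⟨ρ, hρ, hFρ⟩ := hF _ hε
  obtain ⟨hRB₀, hBR₀, hD₀⟩ := hR.self_of_nhds
  have hfin : FiniteDimensional ℝ (LinearMap.range Q.toLinearMap) := by
    rw [hQrange]
    exact finiteDimensional_ker_of_parametrix hRB₀ hD₀
  have hS := eventually_norm_le_mul_of_finiteDimensional (l := 𝓝 p₀)
    (S := fun p => ContinuousLinearMap.id ℝ X - C p - D p) (LinearMap.range Q.toLinearMap)
    (fun v hv => by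
      have h0 : v - C p₀ v - D p₀ v = 0 := by
        rw [hQrange] at hv
        exact hv
      exact h0 ▸ hcont v) hε
  have hPP : ∀ x, P (P x) = P x := fun x => apply_eq_self_of_mem_range hP ⟨x, rfl⟩
  refine ⟨ρ / 2, by positivity, ?_⟩
  filter_upwards [hR, hF0, hFρ, hbd, hS] with p ⟨hRB, hBR, hDc⟩ hF0 hFρ hbd hS δ hδ hδρ v hvQ hv
  have hsurj : ∀ y, ∃ w, Q w = 0 ∧
      (w - C p w - D p w) - P (w - C p w - D p w) = y - P y := fun y =>
    exists_preimage_of_lower_bound (B₀ := ContinuousLinearMap.id ℝ X - C p₀)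
      (B := ContinuousLinearMap.id ℝ X - C p) hRB₀ hBR₀ hD₀ hBR hDc hP hQ hPker hQrange
      (fun w hw h0 => by
        have h1 := hbd w hw
        replace h0 : (w - C p w - D p w) - P (w - C p w - D p w) = 0 := h0
        rw [h0, norm_zero] at h1
        refine norm_le_zero_iff.1 ?_
        by_contra! h2
        nlinarith) (y - P y) (by rw [map_sub, hPP, sub_self])
  have key := existsUnique_ker_of_lower_bound (S := ContinuousLinearMap.id ℝ X - C p - D p)
    (P := P) (Q := Q) (D := D p) (F := F p) hc hδ.le hε.le (by
      rw [mul_div_assoc', mul_div_assoc', div_le_iff₀ (by positivity)]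
      nlinarith) hbd hsurj hF0 (fun x y hx hy => hFρ x y (by linarith) (by linarith)) hv (hS v hvQ)
  have hcancel : ∀ x, (ContinuousLinearMap.id ℝ X - C p - D p) x + D p x - F p x =
      x - C p x - F p x := fun x => by
    change x - C p x - D p x + D p x - F p x = _
    abel
  simpa only [hcancel] using key

end LiapunovSchmidt

section Evaluation

variable {n : ℕ}

theorem continuous_ev (u : Cspace n) : Continuous fun p : ℝ × ℝ => ev u p.1 p.2 :=
  u.continuous.comp ((continuous_projIcc.comp continuous_fst).prodMk
    ((AddCircle.continuous_mk' _).comp continuous_snd))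

theorem abs_ev_le (u : Cspace n) (x t : ℝ) (j : Fin n) : |ev u x t j| ≤ ‖u‖ :=
  (norm_le_pi_norm (ev u x t) j).trans (u.norm_coe_le_norm _)

theorem norm_ev_le (u : Cspace n) (x t : ℝ) : ‖ev u x t‖ ≤ ‖u‖ := u.norm_coe_le_norm _

theorem exists_ev_eq (p : Dom) :
    ∃ t ∈ Icc 0 (2 * π), ∀ v : Cspace n, v p = ev v (p.1 : ℝ) t := by
  obtain ⟨x, t⟩ := p
  obtain ⟨s, hs, rfl⟩ := (AddCircle.coe_image_Icc_eq (2 * π) 0).symm ▸ mem_univ t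
  refine ⟨s, by simpa using hs, fun v => ?_⟩
  simp [ev, projIcc_val]

theorem norm_le_of_abs_ev_le {u : Cspace n} {M : ℝ} (hM : 0 ≤ M)
    (h : ∀ x ∈ Icc (0 : ℝ) 1, ∀ t ∈ Icc 0 (2 * π), ∀ j, |ev u x t j| ≤ M) : ‖u‖ ≤ M := by
  refine (ContinuousMap.norm_le _ hM).2 fun p => ?_
  obtain ⟨t, ht, hp⟩ := exists_ev_eq (n := n) p
  rw [hp]
  exact (pi_norm_le_iff_of_nonneg hM).2 fun j => h _ p.1.2 _ ht j

theorem ev_sub (u v : Cspace n) (x t : ℝ) (j : Fin n) :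
    ev (u - v) x t j = ev u x t j - ev v x t j := rfl

theorem Continuous.ev_apply {Y : Type*} [TopologicalSpace Y] (u : Cspace n) {f g : Y → ℝ}
    (hf : Continuous f) (hg : Continuous g) (j : Fin n) :
    Continuous fun y => ev u (f y) (g y) j :=
  (continuous_apply j).comp ((continuous_ev u).comp (hf.prodMk hg))

/-- Arzelà–Ascoli for operators on `Cspace n`. -/
theorem isCompactOperator_of_uniform_equicontinuous {K : Cspace n →L[ℝ] Cspace n}
    (h : ∀ ε > 0, ∃ η > 0, ∀ u : Cspace n, ‖u‖ ≤ 1 → ∀ x ∈ Icc (0 : ℝ) 1, ∀ x' ∈ Icc (0 : ℝ) 1,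
      |x - x'| ≤ η → ∀ t t' : ℝ, |t - t'| ≤ η → ∀ j,
        |ev (K u) x t j - ev (K u) x' t' j| ≤ ε) : IsCompactOperator K := by
  let Φ := ContinuousMap.isometryEquivBoundedOfCompact Dom (Fin n → ℝ)
  have key : IsCompact (closure (Φ '' (K '' Metric.closedBall 0 1))) := by
    refine BoundedContinuousFunction.arzela_ascoli (Metric.closedBall 0 ‖K‖)
      (isCompact_closedBall _ _) _ ?_ ?_
    · rintro _ p ⟨_, ⟨u, hu, rfl⟩, rfl⟩
      rw [mem_closedBall_zero_iff] at hu ⊢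
      exact ((K u).norm_coe_le_norm p).trans (K.le_of_opNorm_le_of_le le_rfl hu |>.trans_eq
        (mul_one _))
    · rintro ⟨x₀, s₀⟩
      obtain ⟨t₀, rfl⟩ := QuotientAddGroup.mk_surjective s₀
      refine Metric.equicontinuousAt_iff_right.2 fun ε hε => ?_
      obtain ⟨η, hη, hKη⟩ := h (ε / 2) (half_pos hε)
      have h1 : ∀ᶠ x : Icc (0 : ℝ) 1 in 𝓝 x₀, |(x₀ : ℝ) - x| ≤ η := by
        filter_upwards [Metric.ball_mem_nhds x₀ hη] with x hx
        rw [Metric.mem_ball, dist_comm] at hx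
        exact hx.le
      have h2 : ∀ᶠ s : TimeCircle in 𝓝 (t₀ : TimeCircle),
          ∃ t : ℝ, |t₀ - t| ≤ η ∧ (t : TimeCircle) = s := by
        have := (QuotientAddGroup.isOpenMap_coe
          (N := AddSubgroup.zmultiples (2 * π))).image_mem_nhds
          (Metric.ball_mem_nhds t₀ hη)
        filter_upwards [this]
        rintro _ ⟨t, ht, rfl⟩
        rw [Metric.mem_ball, dist_comm] at ht
        exact ⟨t, ht.le, rfl⟩
      rw [nhds_prod_eq]
      filter_upwards [h1.prod_mk h2]
      rintro ⟨x, s⟩ ⟨hx, t, ht, rfl⟩ ⟨_, _, ⟨u, hu, rfl⟩, rfl⟩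
      rw [mem_closedBall_zero_iff] at hu
      refine lt_of_le_of_lt ((dist_pi_le_iff (half_pos hε).le).2 fun j => ?_) (half_lt_self hε)
      have := hKη u hu x₀ x₀.2 x x.2 hx t₀ t ht j
      simp only [ev, projIcc_val] at this
      exact this
  refine (isCompactOperator_iff_isCompact_closure_image_closedBall
    (K : Cspace n →ₗ[ℝ] Cspace n) one_pos).2 ?_
  rw [← Φ.toHomeomorph.isCompact_image, Φ.toHomeomorph.image_closure]
  exact key

end Evaluation

section Oscillation

theorem exists_continuous_leftInverse {φ φ' : ℝ → ℝ} (hφ : ∀ x, HasDerivAt φ (φ' x) x)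
    (hφ' : Continuous φ') (hne : ∀ x ∈ Icc (0 : ℝ) 1, φ' x ≠ 0) :
    ∃ (K : ℝ) (ψ : ℝ → ℝ), 0 < K ∧ Continuous ψ ∧ (∀ y, ψ y ∈ Icc (0 : ℝ) 1) ∧
      (∀ x ∈ Icc (0 : ℝ) 1, ψ (φ x) = x) ∧ ∀ y z, |ψ y - ψ z| ≤ K * |y - z| := by
  obtain ⟨x₀, hx₀, hmin⟩ := isCompact_Icc.exists_isMinOn (nonempty_Icc.2 zero_le_one)
    (hφ'.norm.continuousOn (s := Icc (0 : ℝ) 1))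
  have hκ : 0 < ‖φ' x₀‖ := norm_pos_iff.2 (hne x₀ hx₀)
  have hlt : ∀ x ∈ Icc (0 : ℝ) 1, ∀ y ∈ Icc (0 : ℝ) 1, x < y →
      |x - y| ≤ ‖φ' x₀‖⁻¹ * |φ x - φ y| := by
    intro x hx y hy hxy
    obtain ⟨c, hc, hslope⟩ := exists_hasDerivAt_eq_slope φ φ' hxy
      (fun z _ => (hφ z).continuousAt.continuousWithinAt) (fun z _ => hφ z)
    have h1 : ‖φ' x₀‖ ≤ ‖φ' c‖ := hmin ⟨hx.1.trans hc.1.le, hc.2.le.trans hy.2⟩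
    rw [← div_eq_inv_mul, le_div_iff₀ hκ, abs_sub_comm (φ x), abs_sub_comm x, mul_comm]
    have h2 : φ y - φ x = φ' c * (y - x) := by
      rw [hslope, div_mul_cancel₀ _ (sub_pos.2 hxy).ne']
    rw [h2, abs_mul]
    exact mul_le_mul_of_nonneg_right h1 (abs_nonneg _)
  have hle : ∀ x ∈ Icc (0 : ℝ) 1, ∀ y ∈ Icc (0 : ℝ) 1,
      |x - y| ≤ ‖φ' x₀‖⁻¹ * |φ x - φ y| := by
    intro x hx y hy
    rcases lt_trichotomy x y with h | rfl | h
    · exact hlt x hx y hy h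
    · simp
    · rw [abs_sub_comm, abs_sub_comm (φ x)]
      exact hlt y hy x hx h
  have hinj : InjOn φ (Icc 0 1) := fun x hx y hy hxy => by
    have := hle x hx y hy
    rw [hxy, sub_self, abs_zero, mul_zero] at this
    exact sub_eq_zero.1 (abs_nonpos_iff.1 this)
  obtain ⟨K, hK⟩ : ∃ K : NNReal, (K : ℝ) = ‖φ' x₀‖⁻¹ :=
    ⟨⟨‖φ' x₀‖⁻¹, (inv_pos.2 hκ).le⟩, rfl⟩
  have hlip : LipschitzOnWith K (Function.invFunOn φ (Icc 0 1)) (φ '' Icc 0 1) := by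
    refine LipschitzOnWith.of_dist_le_mul ?_
    rintro _ ⟨x, hx, rfl⟩ _ ⟨y, hy, rfl⟩
    rw [hinj.leftInvOn_invFunOn hx, hinj.leftInvOn_invFunOn hy, hK]
    exact hle x hx y hy
  obtain ⟨ψ, hψ, hψe⟩ := hlip.extend_real
  refine ⟨K, fun y => projIcc (0 : ℝ) 1 zero_le_one (ψ y), hK ▸ inv_pos.2 hκ,
    continuous_subtype_val.comp (continuous_projIcc.comp hψ.continuous),
    fun y => Subtype.coe_prop _,
    fun x hx => ?_, fun y z => ?_⟩
  · have : ψ (φ x) = x := by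
      rw [← hψe (mem_image_of_mem φ hx), hinj.leftInvOn_invFunOn hx]
    simp only [this, projIcc_of_mem _ hx]
  · refine le_trans ?_ (hψ.dist_le_mul y z)
    have := (LipschitzWith.projIcc (zero_le_one' ℝ)).dist_le_mul (ψ y) (ψ z)
    rwa [NNReal.coe_one, one_mul] at this

/-- Integrals along a family of curves transversal to the direction in which the integrands are
uniformly equicontinuous depend uniformly equicontinuously on the transversal parameter. -/
theorem exists_abs_integral_transversal_sub_le {φ φ' h : ℝ → ℝ}
    (hφ : ∀ x, HasDerivAt φ (φ' x) x) (hφ' : Continuous φ')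
    (hne : ∀ x ∈ Icc (0 : ℝ) 1, φ' x ≠ 0) (hh : Continuous h) {M : ℝ} {𝓦 : Set (ℝ → ℝ → ℝ)}
    (hWc : ∀ W ∈ 𝓦, Continuous fun p : ℝ × ℝ => W p.1 p.2)
    (hWM : ∀ W ∈ 𝓦, ∀ x y, |W x y| ≤ M)
    (hW : ∀ ε > 0, ∃ η > 0, ∀ W ∈ 𝓦, ∀ x ∈ Icc (0 : ℝ) 1, ∀ x' ∈ Icc (0 : ℝ) 1, |x - x'| ≤ η →
      ∀ y, |W x y - W x' y| ≤ ε) :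
    ∀ ε > 0, ∃ η > 0, ∀ W ∈ 𝓦, ∀ a ∈ Icc (0 : ℝ) 1, ∀ b ∈ Icc (0 : ℝ) 1, ∀ T T', |T - T'| ≤ η →
      |(∫ x in a..b, h x * φ' x * W x (T + φ x)) - ∫ x in a..b, h x * φ' x * W x (T' + φ x)|
        ≤ ε := by
  intro ε hε
  obtain ⟨K, ψ, hK, hψc, hψI, hψφ, hψK⟩ := exists_continuous_leftInverse hφ hφ' hne
  have hφc : Continuous φ := continuous_iff_continuousAt.2 fun x => (hφ x).continuousAt
  obtain ⟨H, hH⟩ := isCompact_Icc.exists_bound_of_continuousOn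
    (hh.continuousOn (s := Icc (0 : ℝ) 1))
  obtain ⟨B, hB⟩ := isCompact_Icc.exists_bound_of_continuousOn
    (hφc.continuousOn (s := Icc (0 : ℝ) 1))
  have h01 : (0 : ℝ) ∈ Icc (0 : ℝ) 1 := by simp
  have hH0 : 0 ≤ H := (norm_nonneg _).trans (hH 0 h01)
  have hB0 : 0 ≤ B := (norm_nonneg _).trans (hB 0 h01)
  rcases 𝓦.eq_empty_or_nonempty with rfl | ⟨W₀, hW₀⟩
  · exact ⟨1, one_pos, fun W hW => hW.elim⟩
  have hM0 : 0 ≤ M := (abs_nonneg _).trans (hWM W₀ hW₀ 0 0)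
  set ε₁ := ε / (4 * (B + 1) * (M + H + 1))
  have hε₁ : 0 < ε₁ := by positivity
  obtain ⟨η₁, hη₁, hWη⟩ := hW ε₁ hε₁
  obtain ⟨η₂, hη₂, hhη⟩ := Metric.uniformContinuousOn_iff_le.1
    (isCompact_Icc.uniformContinuousOn_of_continuous (hh.continuousOn (s := Icc (0 : ℝ) 1))) ε₁ hε₁
  refine ⟨min (min η₁ η₂ / K) (ε / (4 * (H * M + 1))), by positivity, ?_⟩
  intro W hWW a ha b hb T T' hT
  have hT1 : K * |T - T'| ≤ min η₁ η₂ := by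
    rw [mul_comm, ← le_div_iff₀ hK]
    exact hT.trans (min_le_left _ _)
  have hT2 : |T - T'| * (4 * (H * M + 1)) ≤ ε :=
    (le_div_iff₀ (by positivity)).1 (hT.trans (min_le_right _ _))
  let f : ℝ → ℝ → ℝ := fun S y => h (ψ (y - S)) * W (ψ (y - S)) y
  have hfc : ∀ S, Continuous (f S) := fun S => by
    have h1 : Continuous fun y => ψ (y - S) := hψc.comp (continuous_id.sub continuous_const)
    exact (hh.comp h1).mul ((hWc W hWW).comp (h1.prodMk continuous_id))
  have hchange : ∀ S, ∫ x in a..b, h x * φ' x * W x (S + φ x) =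
      ∫ y in (S + φ a)..(S + φ b), f S y := by
    intro S
    rw [← intervalIntegral.integral_comp_mul_deriv (f := fun x => S + φ x) (f' := φ') (g := f S)
      (fun x _ => (hφ x).const_add S) hφ'.continuousOn (hfc S)]
    refine intervalIntegral.integral_congr fun x hx => ?_
    have hx' : x ∈ Icc (0 : ℝ) 1 := (convex_Icc 0 1).ordConnected.uIcc_subset ha hb hx
    simp only [f, Function.comp_apply, add_sub_cancel_left, hψφ x hx']
    ring
  have hfM : ∀ S y, |f S y| ≤ H * M := fun S y => by
    rw [abs_mul]
    exact mul_le_mul (hH _ (hψI _)) (hWM W hWW _ _) (abs_nonneg _) hH0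
  have hfd : ∀ y, |f T y - f T' y| ≤ (M + H) * ε₁ := by
    intro y
    have hd : |ψ (y - T) - ψ (y - T')| ≤ min η₁ η₂ := by
      refine (hψK _ _).trans (le_trans (le_of_eq ?_) hT1)
      rw [sub_sub_sub_cancel_left, abs_sub_comm]
    have h1 := hhη _ (hψI (y - T)) _ (hψI (y - T')) (hd.trans (min_le_right _ _))
    have h2 := hWη W hWW _ (hψI (y - T)) _ (hψI (y - T')) (hd.trans (min_le_left _ _)) y
    have : f T y - f T' y = (h (ψ (y - T)) - h (ψ (y - T'))) * W (ψ (y - T)) y +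
        h (ψ (y - T')) * (W (ψ (y - T)) y - W (ψ (y - T')) y) := by
      simp only [f]; ring
    rw [this, add_mul]
    refine (abs_add_le _ _).trans (add_le_add ?_ ?_)
    · rw [abs_mul, mul_comm]
      exact mul_le_mul (hWM W hWW _ _) h1 (abs_nonneg _) hM0
    · rw [abs_mul]
      exact mul_le_mul (hH _ (hψI _)) h2 (abs_nonneg _) hH0
  have hi : ∀ S c e, IntervalIntegrable (f S) volume c e := fun S c e =>
    (hfc S).intervalIntegrable _ _
  rw [hchange, hchange]
  have hsplit : (∫ y in (T + φ a)..(T + φ b), f T y) - ∫ y in (T' + φ a)..(T' + φ b), f T' y =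
      (∫ y in (T + φ a)..(T + φ b), (f T y - f T' y)) + ((∫ y in (T + φ a)..(T' + φ a), f T' y) -
        ∫ y in (T + φ b)..(T' + φ b), f T' y) := by
    rw [intervalIntegral.integral_sub (hi _ _ _) (hi _ _ _),
      ← intervalIntegral.integral_interval_sub_interval_comm (hi _ _ _) (hi _ _ _) (hi _ _ _)]
    ring
  have e1 := intervalIntegral.norm_integral_le_of_norm_le_const (a := T + φ a) (b := T + φ b)
    (f := fun y => f T y - f T' y) (fun y _ => hfd y)
  have e2 := intervalIntegral.norm_integral_le_of_norm_le_const (a := T + φ a) (b := T' + φ a)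
    (f := f T') (fun y _ => hfM T' y)
  have e3 := intervalIntegral.norm_integral_le_of_norm_le_const (a := T + φ b) (b := T' + φ b)
    (f := f T') (fun y _ => hfM T' y)
  rw [add_sub_add_left_eq_sub] at e1
  rw [add_sub_add_right_eq_sub, abs_sub_comm] at e2 e3
  have hab : |φ b - φ a| ≤ 2 * B := by
    have := hB a ha
    have := hB b hb
    exact (abs_sub _ _).trans (by simp only [Real.norm_eq_abs] at *; linarith)
  have e1' : (M + H) * ε₁ * |φ b - φ a| ≤ ε / 2 := by
    have : (M + H) * ε₁ * |φ b - φ a| ≤ (M + H + 1) * ε₁ * (2 * (B + 1)) := by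
      exact mul_le_mul (mul_le_mul_of_nonneg_right (by linarith) hε₁.le) (by linarith)
        (abs_nonneg _) (by positivity)
    refine this.trans_eq ?_
    simp only [ε₁]
    field_simp
    ring
  rw [hsplit]
  refine (abs_add_le _ _).trans ?_
  refine (add_le_add (e1.trans e1') ((abs_sub _ _).trans (add_le_add e2 e3))).trans ?_
  nlinarith [abs_nonneg (T - T')]

end Oscillation

section CharacteristicOperators

variable {n : ℕ}

/-- The operator transporting boundary values at `s j` along the characteristics `φ j`. -/
def IsBoundaryOperator (s : Fin n → ℝ) (β φ : Fin n → ℝ → ℝ) (ρ : Fin n → Fin n → ℝ)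
    (C : Cspace n →L[ℝ] Cspace n) : Prop :=
  ∀ u, ∀ x ∈ Icc (0 : ℝ) 1, ∀ t j, ev (C u) x t j =
    rexp (β j (s j) - β j x) * ∑ k, ρ j k * ev u (s j) (t + (φ j (s j) - φ j x)) k

/-- The operator integrating a coupling of the components along the characteristics `φ j`. -/
def IsCouplingOperator (s : Fin n → ℝ) (β φ : Fin n → ℝ → ℝ) (g : Fin n → Fin n → ℝ → ℝ)
    (D : Cspace n →L[ℝ] Cspace n) : Prop :=
  ∀ u, ∀ x ∈ Icc (0 : ℝ) 1, ∀ t j, ev (D u) x t j =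
    ∫ ξ in (s j)..x, rexp (β j ξ - β j x) * ∑ k, g j k ξ * ev u ξ (t + (φ j ξ - φ j x)) k

/-- Uniform equicontinuity along the characteristics `φ k`. -/
def CharEquicontinuous (φ : Fin n → ℝ → ℝ) (𝓦 : Set (Cspace n)) : Prop :=
  ∀ ε > 0, ∃ η > 0, ∀ w ∈ 𝓦, ∀ x ∈ Icc (0 : ℝ) 1, ∀ x' ∈ Icc (0 : ℝ) 1, |x - x'| ≤ η →
    ∀ y k, |ev w x (y + φ k x) k - ev w x' (y + φ k x') k| ≤ ε

theorem exists_pos_forall_of_finite {ι : Type*} [Finite ι] {p : ι → ℝ → Prop}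
    (hp : ∀ i, ∃ η > 0, p i η) (hmono : ∀ i η η', η' ≤ η → p i η → p i η') :
    ∃ η > 0, ∀ i, p i η := by
  choose η hη hpη using hp
  rcases isEmpty_or_nonempty ι with h | h
  · exact ⟨1, one_pos, fun i => h.elim i⟩
  · obtain ⟨i₀, hi₀⟩ := Finite.exists_min η
    exact ⟨η i₀, hη i₀, fun i => hmono i _ _ (hi₀ i) (hpη i)⟩

theorem exists_abs_exp_mul_sub_le {β : Fin n → ℝ → ℝ} (hβ : ∀ j, Continuous (β j)) {M L : ℝ}
    (hM : 0 ≤ M) (hL : 0 ≤ L) : ∀ ε > 0, ∃ η > 0, ∀ j, ∀ x ∈ Icc (0 : ℝ) 1,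
      ∀ x' ∈ Icc (0 : ℝ) 1, |x - x'| ≤ η → ∀ p p', |p| ≤ M → |p - p'| ≤ L * |x - x'| →
        |rexp (-β j x) * p - rexp (-β j x') * p'| ≤ ε := by
  intro ε hε
  refine exists_pos_forall_of_finite (fun j => ?_) (fun j η η' hη h x hx x' hx' hxx =>
    h x hx x' hx' (hxx.trans hη))
  have hc : ContinuousOn (fun x => rexp (-β j x)) (Icc 0 1) :=
    (Real.continuous_exp.comp (hβ j).neg).continuousOn
  obtain ⟨B, hB⟩ := isCompact_Icc.exists_bound_of_continuousOn hc
  have hB0 : 0 ≤ B := (norm_nonneg _).trans (hB 0 (by simp))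
  obtain ⟨η, hη, h⟩ := Metric.uniformContinuousOn_iff_le.1
    (isCompact_Icc.uniformContinuousOn_of_continuous hc) (ε / (2 * (M + 1))) (by positivity)
  refine ⟨min η (ε / (2 * (B * L + 1))), by positivity, ?_⟩
  intro x hx x' hx' hxx p p' hp hpp
  have h1 := h x hx x' hx' (hxx.trans (min_le_left _ _))
  have h2 := (le_div_iff₀ (by positivity)).1 (hxx.trans (min_le_right _ _))
  have h3 := hB x' hx'
  rw [Real.dist_eq] at h1
  rw [Real.norm_eq_abs] at h3
  have h4 : rexp (-β j x) * p - rexp (-β j x') * p' =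
      (rexp (-β j x) - rexp (-β j x')) * p + rexp (-β j x') * (p - p') := by ring
  rw [h4]
  refine (abs_add_le _ _).trans ?_
  rw [abs_mul, abs_mul]
  have h5 := mul_le_mul h1 hp (abs_nonneg _) (by positivity)
  have h6 := mul_le_mul h3 hpp (abs_nonneg _) hB0
  have h7 : ε / (2 * (M + 1)) * M ≤ ε / 2 := by
    rw [div_mul_eq_mul_div, div_le_div_iff₀ (by positivity) two_pos]
    nlinarith
  nlinarith [abs_nonneg (x - x')]

theorem abs_sum_mul_ev_le (c : Fin n → ℝ) {M : ℝ} {u : Cspace n} (hu : ‖u‖ ≤ M) (x t : ℝ) :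
    |∑ k, c k * ev u x t k| ≤ (∑ k, |c k|) * M := by
  rw [Finset.sum_mul]
  refine (Finset.abs_sum_le_sum_abs _ _).trans (Finset.sum_le_sum fun k _ => ?_)
  rw [abs_mul]
  exact mul_le_mul_of_nonneg_left ((abs_ev_le u x t k).trans hu) (abs_nonneg _)

theorem IsBoundaryOperator.charEquicontinuous {s : Fin n → ℝ} {β φ : Fin n → ℝ → ℝ}
    {ρ : Fin n → Fin n → ℝ} {C : Cspace n →L[ℝ] Cspace n} (hC : IsBoundaryOperator s β φ ρ C)
    (hβ : ∀ j, Continuous (β j)) {M : ℝ} (hM : 0 ≤ M) :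
    CharEquicontinuous φ (C '' {u | ‖u‖ ≤ M}) := by
  intro ε hε
  set N : Fin n → ℝ := fun j => rexp (β j (s j)) * ((∑ k, |ρ j k|) * M)
  have hN : ∀ j, 0 ≤ N j := fun j => by positivity
  obtain ⟨η, hη, h⟩ := exists_abs_exp_mul_sub_le hβ (M := ∑ j, N j) (L := 0)
    (Finset.sum_nonneg fun j _ => hN j) le_rfl ε hε
  refine ⟨η, hη, ?_⟩
  rintro _ ⟨u, hu, rfl⟩ x hx x' hx' hxx y j
  have hval : ∀ z ∈ Icc (0 : ℝ) 1, ev (C u) z (y + φ j z) j = rexp (-β j z) *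
      (rexp (β j (s j)) * ∑ k, ρ j k * ev u (s j) (y + φ j (s j)) k) := fun z hz => by
    rw [hC u z hz, sub_eq_neg_add, Real.exp_add, mul_assoc, add_add_sub_cancel]
  rw [hval x hx, hval x' hx']
  refine h j x hx x' hx' hxx _ _ ?_ (by simp)
  refine le_trans ?_ (Finset.single_le_sum (fun j _ => hN j) (Finset.mem_univ j))
  rw [abs_mul, Real.abs_exp]
  exact mul_le_mul_of_nonneg_left (abs_sum_mul_ev_le _ hu _ _) (Real.exp_pos _).le

theorem continuous_coupling {f : ℝ → ℝ} {g : Fin n → ℝ → ℝ} {φ : ℝ → ℝ} (hf : Continuous f)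
    (hg : ∀ k, Continuous (g k)) (hφ : Continuous φ) (u : Cspace n) (y : ℝ) :
    Continuous fun ξ => f ξ * ∑ k, g k ξ * ev u ξ (y + φ ξ) k :=
  hf.mul (continuous_finsetSum _ fun k _ => (hg k).mul
    (continuous_id.ev_apply u (continuous_const.add hφ) k))

theorem IsCouplingOperator.ev_characteristic {s : Fin n → ℝ} {β φ : Fin n → ℝ → ℝ}
    {g : Fin n → Fin n → ℝ → ℝ} {D : Cspace n →L[ℝ] Cspace n} (hD : IsCouplingOperator s β φ g D)
    (u : Cspace n) {x : ℝ} (hx : x ∈ Icc (0 : ℝ) 1) (y : ℝ) (j : Fin n) :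
    ev (D u) x (y + φ j x) j = rexp (-β j x) *
      ∫ ξ in (s j)..x, rexp (β j ξ) * ∑ k, g j k ξ * ev u ξ (y + φ j ξ) k := by
  rw [hD u x hx, ← intervalIntegral.integral_const_mul]
  refine intervalIntegral.integral_congr fun ξ _ => ?_
  have e : y + φ j x + (φ j ξ - φ j x) = y + φ j ξ := by ring
  simp only [e, sub_eq_neg_add (β j ξ), Real.exp_add, mul_assoc]

theorem IsCouplingOperator.charEquicontinuous {s : Fin n → ℝ} {β φ : Fin n → ℝ → ℝ}
    {g : Fin n → Fin n → ℝ → ℝ} {D : Cspace n →L[ℝ] Cspace n} (hD : IsCouplingOperator s β φ g D)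
    (hs : ∀ j, s j ∈ Icc (0 : ℝ) 1) (hβ : ∀ j, Continuous (β j)) (hφ : ∀ j, Continuous (φ j))
    (hg : ∀ j k, Continuous (g j k)) {M : ℝ} (hM : 0 ≤ M) :
    CharEquicontinuous φ (D '' {u | ‖u‖ ≤ M}) := by
  intro ε hε
  have hbd : ∀ j, ∃ N, 0 ≤ N ∧ ∀ x ∈ Icc (0 : ℝ) 1, rexp (β j x) * (∑ k, |g j k x|) ≤ N := by
    intro j
    have hc : Continuous fun x => rexp (β j x) * (∑ k, |g j k x|) :=
      (Real.continuous_exp.comp (hβ j)).mul (continuous_finsetSum _ fun k _ => (hg j k).abs)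
    obtain ⟨N, hN⟩ := isCompact_Icc.exists_bound_of_continuousOn (hc.continuousOn (s := Icc 0 1))
    exact ⟨N, (norm_nonneg _).trans (hN 0 (by simp)), fun x hx => (le_abs_self _).trans (hN x hx)⟩
  choose N hN0 hN using hbd
  have hNM : 0 ≤ (∑ j, N j) * M := mul_nonneg (Finset.sum_nonneg fun j _ => hN0 j) hM
  obtain ⟨η, hη, h⟩ := exists_abs_exp_mul_sub_le hβ hNM hNM ε hε
  refine ⟨η, hη, ?_⟩
  rintro _ ⟨u, hu, rfl⟩ x hx x' hx' hxx y j
  rw [hD.ev_characteristic u hx, hD.ev_characteristic u hx']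
  set G : ℝ → ℝ := fun ξ => rexp (β j ξ) * ∑ k, g j k ξ * ev u ξ (y + φ j ξ) k
  have hG : Continuous G := continuous_coupling (Real.continuous_exp.comp (hβ j)) (hg j) (hφ j) u y
  have hGb : ∀ ξ ∈ Icc (0 : ℝ) 1, ‖G ξ‖ ≤ (∑ j, N j) * M := fun ξ hξ => by
    rw [Real.norm_eq_abs, abs_mul, Real.abs_exp]
    calc rexp (β j ξ) * |∑ k, g j k ξ * ev u ξ (y + φ j ξ) k|
        ≤ rexp (β j ξ) * ((∑ k, |g j k ξ|) * M) :=
          mul_le_mul_of_nonneg_left (abs_sum_mul_ev_le _ hu _ _) (Real.exp_pos _).le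
      _ = rexp (β j ξ) * (∑ k, |g j k ξ|) * M := by ring
      _ ≤ (∑ j, N j) * M := mul_le_mul_of_nonneg_right ((hN j ξ hξ).trans
          (Finset.single_le_sum (fun j _ => hN0 j) (Finset.mem_univ j))) hM
  have hGi : ∀ a ∈ Icc (0 : ℝ) 1, ∀ b ∈ Icc (0 : ℝ) 1,
      |∫ ξ in a..b, G ξ| ≤ (∑ j, N j) * M * |b - a| := fun a ha b hb =>
    intervalIntegral.norm_integral_le_of_norm_le_const fun ξ hξ => hGb ξ
      ((convex_Icc 0 1).ordConnected.uIcc_subset ha hb (uIoc_subset_uIcc hξ))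
  refine h j x hx x' hx' hxx _ _ ?_ ?_
  · refine (hGi _ (hs j) _ hx).trans (mul_le_of_le_one_right hNM ?_)
    have := hs j
    rw [mem_Icc] at this hx
    exact abs_le.2 ⟨by linarith, by linarith⟩
  · rw [intervalIntegral.integral_interval_sub_left (hG.intervalIntegrable _ _)
      (hG.intervalIntegrable _ _)]
    exact hGi _ hx' _ hx

/-- The coupling operator maps bounded characteristically equicontinuous families to uniformly
equicontinuous families, since distinct components travel along transversal characteristics. -/
theorem IsCouplingOperator.exists_abs_sub_le {s : Fin n → ℝ} {β φ φ' : Fin n → ℝ → ℝ}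
    {g : Fin n → Fin n → ℝ → ℝ} {D : Cspace n →L[ℝ] Cspace n} (hD : IsCouplingOperator s β φ g D)
    (hs : ∀ j, s j ∈ Icc (0 : ℝ) 1) (hβ : ∀ j, Continuous (β j))
    (hφ : ∀ j x, HasDerivAt (φ j) (φ' j x) x) (hφ' : ∀ j, Continuous (φ' j))
    (hg : ∀ j k, Continuous (g j k)) (hgd : ∀ j, g j j = 0)
    (hne : ∀ j k, j ≠ k → ∀ x ∈ Icc (0 : ℝ) 1, φ' j x ≠ φ' k x) {M : ℝ} (hM : 0 ≤ M)
    {𝓦 : Set (Cspace n)} (hWM : ∀ w ∈ 𝓦, ‖w‖ ≤ M) (hW : CharEquicontinuous φ 𝓦) :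
    ∀ ε > 0, ∃ η > 0, ∀ w ∈ 𝓦, ∀ x ∈ Icc (0 : ℝ) 1, ∀ x' ∈ Icc (0 : ℝ) 1,
      |x - x'| ≤ η → ∀ t t' : ℝ, |t - t'| ≤ η → ∀ j,
        |ev (D w) x t j - ev (D w) x' t' j| ≤ ε := by
  intro ε hε
  have hφc : ∀ j, Continuous (φ j) := fun j =>
    continuous_iff_continuousAt.2 fun x => (hφ j x).continuousAt
  have htrans : ∀ ε > 0, ∃ η > 0, ∀ jk : Fin n × Fin n, ∀ w ∈ 𝓦, ∀ a ∈ Icc (0 : ℝ) 1,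
      ∀ b ∈ Icc (0 : ℝ) 1, ∀ y y', |y - y'| ≤ η →
        |(∫ ξ in a..b, rexp (β jk.1 ξ) * (g jk.1 jk.2 ξ * ev w ξ (y + φ jk.1 ξ) jk.2)) -
          ∫ ξ in a..b, rexp (β jk.1 ξ) * (g jk.1 jk.2 ξ * ev w ξ (y' + φ jk.1 ξ) jk.2)| ≤ ε := by
    intro ε hε
    refine exists_pos_forall_of_finite ?_ (fun jk η η' hη h w hw a ha b hb y y' hy =>
      h w hw a ha b hb y y' (hy.trans hη))
    rintro ⟨j, k⟩
    rcases eq_or_ne j k with rfl | hjk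
    · exact ⟨1, one_pos, fun w _ a _ b _ y y' _ => by simpa [hgd] using hε.le⟩
    let c : ℝ → ℝ := fun x => projIcc (0 : ℝ) 1 zero_le_one x
    have hc : Continuous c := continuous_subtype_val.comp continuous_projIcc
    let h : ℝ → ℝ := fun x => rexp (β j (c x)) * g j k (c x) / (φ' j (c x) - φ' k (c x))
    have hh : Continuous h :=
      ((Real.continuous_exp.comp ((hβ j).comp hc)).mul ((hg j k).comp hc)).div
        (((hφ' j).comp hc).sub ((hφ' k).comp hc))
        fun x => sub_ne_zero.2 (hne j k hjk _ (Subtype.coe_prop _))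
    obtain ⟨η, hη, H⟩ := exists_abs_integral_transversal_sub_le
      (φ := fun x => φ j x - φ k x) (φ' := fun x => φ' j x - φ' k x) (h := h) (M := M)
      (𝓦 := (fun w x y => ev w x (y + φ k x) k) '' 𝓦) (fun x => (hφ j x).sub (hφ k x))
      ((hφ' j).sub (hφ' k)) (fun x hx => sub_ne_zero.2 (hne j k hjk x hx)) hh
      (by
        rintro _ ⟨w, -, rfl⟩
        exact continuous_fst.ev_apply w
          (continuous_snd.add ((hφc k).comp continuous_fst)) k)
      (by
        rintro _ ⟨w, hw, rfl⟩ x y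
        exact (abs_ev_le _ _ _ _).trans (hWM w hw))
      (fun ε hε => by
        obtain ⟨η, hη, h⟩ := hW ε hε
        refine ⟨η, hη, ?_⟩
        rintro _ ⟨w, hw, rfl⟩ x hx x' hx' hxx y
        exact h w hw x hx x' hx' hxx y k) ε hε
    refine ⟨η, hη, fun w hw a ha b hb y y' hy => ?_⟩
    have hcross : ∀ z, ∫ ξ in a..b, rexp (β j ξ) * (g j k ξ * ev w ξ (z + φ j ξ) k) =
        ∫ ξ in a..b, h ξ * (φ' j ξ - φ' k ξ) * ev w ξ (z + (φ j ξ - φ k ξ) + φ k ξ) k := by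
      intro z
      refine intervalIntegral.integral_congr fun ξ hξ => ?_
      have hξ' : ξ ∈ Icc (0 : ℝ) 1 := (convex_Icc 0 1).ordConnected.uIcc_subset ha hb hξ
      have hcξ : c ξ = ξ := by simp only [c, projIcc_of_mem _ hξ']
      have e : z + (φ j ξ - φ k ξ) + φ k ξ = z + φ j ξ := by ring
      simp only [h, hcξ, e]
      rw [div_mul_cancel₀ _ (sub_ne_zero.2 (hne j k hjk ξ hξ')), mul_assoc]
    simp only [hcross]
    exact H _ ⟨w, hw, rfl⟩ a ha b hb y y' hy
  have hexp : ∀ j, ∃ B, 0 ≤ B ∧ ∀ x ∈ Icc (0 : ℝ) 1, rexp (-β j x) ≤ B := fun j => by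
    obtain ⟨B, hB⟩ := isCompact_Icc.exists_bound_of_continuousOn
      ((Real.continuous_exp.comp (hβ j).neg).continuousOn (s := Icc (0 : ℝ) 1))
    exact ⟨B, (norm_nonneg _).trans (hB 0 (by simp)), fun x hx => (le_abs_self _).trans (hB x hx)⟩
  choose B hB0 hB using hexp
  have hBs : 0 ≤ ∑ j, B j := Finset.sum_nonneg fun j _ => hB0 j
  obtain ⟨η₁, hη₁, h₁⟩ := htrans (ε / (2 * (n + 1) * (∑ j, B j + 1))) (by positivity)
  obtain ⟨η₂, hη₂, h₂⟩ := hD.charEquicontinuous hs hβ hφc hg hM (ε / 2) (half_pos hε)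
  obtain ⟨η₃, hη₃, h₃⟩ : ∃ η > 0, ∀ j, ∀ x ∈ Icc (0 : ℝ) 1, ∀ x' ∈ Icc (0 : ℝ) 1, |x - x'| ≤ η →
      |φ j x - φ j x'| ≤ η₁ / 2 :=
    exists_pos_forall_of_finite
      (fun j => Metric.uniformContinuousOn_iff_le.1 (isCompact_Icc.uniformContinuousOn_of_continuous
        (hφc j).continuousOn) _ (half_pos hη₁))
      (fun j η η' hη h x hx x' hx' hxx => h x hx x' hx' (hxx.trans hη))
  refine ⟨min (min η₂ η₃) (η₁ / 2), by positivity, fun w hw x hx x' hx' hxx t t' htt j => ?_⟩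
  have hy : |t - φ j x - (t' - φ j x')| ≤ η₁ := by
    have e : t - φ j x - (t' - φ j x') = (t - t') - (φ j x - φ j x') := by ring
    rw [e]
    refine (abs_sub _ _).trans ?_
    linarith [htt.trans (min_le_right _ _),
      h₃ j x hx x' hx' (hxx.trans ((min_le_left _ _).trans (min_le_right _ _)))]
  have e₁ := h₂ _ ⟨w, hWM w hw, rfl⟩ x hx x' hx'
    (hxx.trans ((min_le_left _ _).trans (min_le_left _ _))) (t - φ j x) j
  rw [sub_add_cancel] at e₁
  have e₂ : |ev (D w) x' (t - φ j x + φ j x') j - ev (D w) x' t' j| ≤ ε / 2 := by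
    have hsum : ∀ y, ∫ ξ in (s j)..x', rexp (β j ξ) * ∑ k, g j k ξ * ev w ξ (y + φ j ξ) k =
        ∑ k, ∫ ξ in (s j)..x', rexp (β j ξ) * (g j k ξ * ev w ξ (y + φ j ξ) k) := fun y => by
      simp only [Finset.mul_sum]
      refine intervalIntegral.integral_finsetSum fun k _ => Continuous.intervalIntegrable ?_ _ _
      exact (Real.continuous_exp.comp (hβ j)).mul ((hg j k).mul
        (continuous_id.ev_apply w (continuous_const.add (hφc j)) k))
    have e₃ := hD.ev_characteristic w hx' (t' - φ j x') j
    rw [sub_add_cancel] at e₃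
    rw [hD.ev_characteristic w hx', e₃, ← mul_sub, abs_mul, Real.abs_exp, hsum, hsum,
      ← Finset.sum_sub_distrib]
    have e₄ : |∑ k, ((∫ ξ in (s j)..x', rexp (β j ξ) * (g j k ξ *
        ev w ξ (t - φ j x + φ j ξ) k)) - ∫ ξ in (s j)..x', rexp (β j ξ) * (g j k ξ *
        ev w ξ (t' - φ j x' + φ j ξ) k))| ≤ n * (ε / (2 * (n + 1) * (∑ j, B j + 1))) := by
      refine (Finset.abs_sum_le_sum_abs _ _).trans ?_
      refine (Finset.sum_le_card_nsmul _ _ _ fun k _ =>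
        h₁ (j, k) w hw _ (hs j) x' hx' _ _ hy).trans_eq ?_
      simp
    refine (mul_le_mul ((hB j x' hx').trans (Finset.single_le_sum (fun j _ => hB0 j)
      (Finset.mem_univ j))) e₄ (abs_nonneg _) hBs).trans ?_
    rw [mul_div_assoc', mul_div_assoc', div_le_div_iff₀ (by positivity) two_pos]
    have : 0 ≤ ε * ((n : ℝ) + ∑ j, B j + 1) := by positivity
    nlinarith
  calc _ ≤ _ := abs_sub_le _ (ev (D w) x' (t - φ j x + φ j x') j) _
    _ ≤ ε / 2 + ε / 2 := add_le_add e₁ e₂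
    _ = ε := add_halves ε

theorem IsCouplingOperator.isCompactOperator_comp {s : Fin n → ℝ} {β φ φ' : Fin n → ℝ → ℝ}
    {g : Fin n → Fin n → ℝ → ℝ} {D T : Cspace n →L[ℝ] Cspace n}
    (hD : IsCouplingOperator s β φ g D)
    (hs : ∀ j, s j ∈ Icc (0 : ℝ) 1) (hβ : ∀ j, Continuous (β j))
    (hφ : ∀ j x, HasDerivAt (φ j) (φ' j x) x) (hφ' : ∀ j, Continuous (φ' j))
    (hg : ∀ j k, Continuous (g j k)) (hgd : ∀ j, g j j = 0)
    (hne : ∀ j k, j ≠ k → ∀ x ∈ Icc (0 : ℝ) 1, φ' j x ≠ φ' k x)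
    (hT : CharEquicontinuous φ (T '' {u | ‖u‖ ≤ 1})) : IsCompactOperator (D ∘L T) := by
  refine isCompactOperator_of_uniform_equicontinuous fun ε hε => ?_
  obtain ⟨η, hη, h⟩ := hD.exists_abs_sub_le hs hβ hφ hφ' hg hgd hne (norm_nonneg T)
    (by
      rintro _ ⟨u, hu, rfl⟩
      exact (T.le_of_opNorm_le_of_le le_rfl hu).trans_eq (mul_one _)) hT ε hε
  exact ⟨η, hη, fun u hu => h _ ⟨u, hu, rfl⟩⟩

theorem IsCouplingOperator.isCompactOperator_comp_resolvent {s : Fin n → ℝ}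
    {β φ φ' : Fin n → ℝ → ℝ} {g : Fin n → Fin n → ℝ → ℝ} {ρ : Fin n → Fin n → ℝ}
    {C D R : Cspace n →L[ℝ] Cspace n} (hC : IsBoundaryOperator s β φ ρ C)
    (hD : IsCouplingOperator s β φ g D)
    (hs : ∀ j, s j ∈ Icc (0 : ℝ) 1) (hβ : ∀ j, Continuous (β j))
    (hφ : ∀ j x, HasDerivAt (φ j) (φ' j x) x) (hφ' : ∀ j, Continuous (φ' j))
    (hg : ∀ j k, Continuous (g j k)) (hgd : ∀ j, g j j = 0)
    (hne : ∀ j k, j ≠ k → ∀ x ∈ Icc (0 : ℝ) 1, φ' j x ≠ φ' k x)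
    (hR : ∀ u, R u - C (R u) = u) : IsCompactOperator (D ∘L R ∘L D) := by
  have hφc : ∀ j, Continuous (φ j) := fun j =>
    continuous_iff_continuousAt.2 fun x => (hφ j x).continuousAt
  have h1 := hD.isCompactOperator_comp hs hβ hφ hφ' hg hgd hne
    (hD.charEquicontinuous hs hβ hφc hg zero_le_one)
  have h2 := hD.isCompactOperator_comp hs hβ hφ hφ' hg hgd hne
    (hC.charEquicontinuous hβ zero_le_one)
  refine (congrArg IsCompactOperator (funext fun u => ?_)).mp (h1.add (h2.comp_clm (R ∘L D)))
  change D (D u) + D (C (R (D u))) = D (R (D u))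
  rw [← map_add]
  exact congrArg D (sub_eq_iff_eq_add.1 (hR (D u))).symm

end CharacteristicOperators

section BoundaryResolvent

theorem exists_resolvent_of_norm_comp_self_lt_one {X : Type*} [NormedAddCommGroup X]
    [NormedSpace ℝ X] [CompleteSpace X] {C : X →L[ℝ] X} (hC : ‖C ∘L C‖ < 1) :
    ∃ R : X →L[ℝ] X, (∀ x, R (x - C x) = x) ∧ ∀ x, R x - C (R x) = x := by
  have h1 : IsUnit (1 - C * C) := isUnit_one_sub_of_norm_lt_one hC
  have h2 : 1 - C * C = (1 - C) * (1 + C) := by noncomm_ring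
  have h3 : Commute (1 - C) (1 + C) := by
    change (1 - C) * (1 + C) = (1 + C) * (1 - C)
    noncomm_ring
  rw [h2, h3.isUnit_mul_iff] at h1
  obtain ⟨R, hR⟩ := h1.1
  refine ⟨(R⁻¹ : (X →L[ℝ] X)ˣ), fun x => ?_, fun x => ?_⟩
  · have := R.inv_mul
    rw [hR] at this
    exact congrArg (fun T : X →L[ℝ] X => T x) this
  · have := R.mul_inv
    rw [hR] at this
    exact congrArg (fun T : X →L[ℝ] X => T x) this

variable {n : ℕ}

theorem IsBoundaryOperator.abs_ev_le_of_forall {s : Fin n → ℝ} {β φ : Fin n → ℝ → ℝ}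
    {ρ : Fin n → Fin n → ℝ} {C : Cspace n →L[ℝ] Cspace n} (hC : IsBoundaryOperator s β φ ρ C)
    (hs : ∀ j, s j ∈ Icc (0 : ℝ) 1) {j : Fin n} {r N : ℝ} (hN : 0 ≤ N)
    (hr : ∀ x ∈ Icc (0 : ℝ) 1, rexp (β j (s j) - β j x) * ∑ k, |ρ j k| ≤ r) {u : Cspace n}
    (hu : ∀ k, ρ j k ≠ 0 → ∀ x ∈ Icc (0 : ℝ) 1, ∀ t, |ev u x t k| ≤ N)
    {x : ℝ} (hx : x ∈ Icc (0 : ℝ) 1) (t : ℝ) : |ev (C u) x t j| ≤ r * N := by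
  rw [hC u x hx, abs_mul, Real.abs_exp]
  refine le_trans (mul_le_mul_of_nonneg_left ?_ (Real.exp_pos _).le)
    ((mul_assoc _ _ _).symm.trans_le (mul_le_mul_of_nonneg_right (hr x hx) hN))
  rw [Finset.sum_mul]
  refine (Finset.abs_sum_le_sum_abs _ _).trans (Finset.sum_le_sum fun k _ => ?_)
  rw [abs_mul]
  rcases eq_or_ne (ρ j k) 0 with h | h
  · simp [h]
  · exact mul_le_mul_of_nonneg_left (hu k h _ (hs j) _) (abs_nonneg _)

/-- Two-step contractivity of reflections between two groups of components. -/
theorem IsBoundaryOperator.norm_comp_self_le {s : Fin n → ℝ} {β φ : Fin n → ℝ → ℝ}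
    {ρ : Fin n → Fin n → ℝ} {C : Cspace n →L[ℝ] Cspace n} (hC : IsBoundaryOperator s β φ ρ C)
    (hs : ∀ j, s j ∈ Icc (0 : ℝ) 1) {q : Fin n → Prop} {r₀ r₁ : ℝ} (hr₀ : 0 ≤ r₀) (hr₁ : 0 ≤ r₁)
    (hq : ∀ j k, ρ j k ≠ 0 → (q k ↔ ¬ q j))
    (h₀ : ∀ j, q j → ∀ x ∈ Icc (0 : ℝ) 1, rexp (β j (s j) - β j x) * ∑ k, |ρ j k| ≤ r₀)
    (h₁ : ∀ j, ¬ q j → ∀ x ∈ Icc (0 : ℝ) 1, rexp (β j (s j) - β j x) * ∑ k, |ρ j k| ≤ r₁) :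
    ‖C ∘L C‖ ≤ r₀ * r₁ := by
  refine ContinuousLinearMap.opNorm_le_bound _ (mul_nonneg hr₀ hr₁) fun u => ?_
  have hu := norm_nonneg u
  refine norm_le_of_abs_ev_le (by positivity) fun x hx t _ j => ?_
  rcases Classical.em (q j) with hj | hj
  · rw [mul_assoc]
    refine hC.abs_ev_le_of_forall hs (by positivity) (h₀ j hj) (fun k hk y hy t' => ?_) hx t
    have hk' : ¬ q k := fun h => (hq j k hk).1 h hj
    exact hC.abs_ev_le_of_forall hs hu (h₁ k hk') (fun l _ z _ t'' => abs_ev_le _ _ _ _) hy t'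
  · rw [mul_comm r₀, mul_assoc]
    refine hC.abs_ev_le_of_forall hs (by positivity) (h₁ j hj) (fun k hk y hy t' => ?_) hx t
    have hk' : q k := (hq j k hk).2 hj
    exact hC.abs_ev_le_of_forall hs hu (h₀ k hk') (fun l _ z _ t'' => abs_ev_le _ _ _ _) hy t'

end BoundaryResolvent

section Model

theorem exists_continuous_eqOn_rectangle {f : ℝ → ℝ → ℝ} {δ : ℝ} (hδ : 0 ≤ δ)
    (hf : ContinuousOn (Function.uncurry f) (Icc (-δ) δ ×ˢ Icc (0 : ℝ) 1)) :
    ∃ g : ℝ → ℝ → ℝ, Continuous (Function.uncurry g) ∧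
      ∀ lam ∈ Icc (-δ) δ, ∀ x ∈ Icc (0 : ℝ) 1, g lam x = f lam x := by
  have hδ' : -δ ≤ δ := by linarith
  refine ⟨fun lam x => f (projIcc (-δ) δ hδ' lam) (projIcc 0 1 zero_le_one x), ?_, ?_⟩
  · refine hf.comp_continuous (f := fun y : ℝ × ℝ =>
      ((projIcc (-δ) δ hδ' y.1 : ℝ), (projIcc 0 1 zero_le_one y.2 : ℝ))) ?_ ?_
    · exact (continuous_subtype_val.comp (continuous_projIcc.comp continuous_fst)).prodMk
        (continuous_subtype_val.comp (continuous_projIcc.comp continuous_snd))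
    · exact fun y => ⟨Subtype.coe_prop _, Subtype.coe_prop _⟩
  · intro lam hlam x hx
    simp only [projIcc_of_mem hδ' hlam, projIcc_of_mem zero_le_one hx]

theorem xjv_mem_Icc {n m : ℕ} (j : Fin n) : xjv m j ∈ Icc (0 : ℝ) 1 := by
  unfold xjv
  split_ifs <;> simp

theorem continuous_primitive_of_uncurry {f : ℝ → ℝ → ℝ} (hf : Continuous (Function.uncurry f)) :
    Continuous (Function.uncurry fun lam x => ∫ η in (0 : ℝ)..x, f lam η) :=
  intervalIntegral.continuous_parametric_intervalIntegral_of_continuous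
    (f := fun (y : ℝ × ℝ) η => f y.1 η) (s := fun y : ℝ × ℝ => y.2)
    (hf.comp ((continuous_fst.comp continuous_fst).prodMk continuous_snd)) continuous_snd

/-- Globally continuous functions `p`, `α`, `β`, `g` which, on `[0,1]` and for `|λ| ≤ δ`, are
`1 / a_j`, primitives of `1 / a_j` and of `∂_{u_j} b_j / a_j`, and the coupling coefficients
`-∂_{u_k} b_j / a_j`, `k ≠ j`. -/
structure HypData.IsModel {n m : ℕ} (d : HypData n m) (δ : ℝ) (p α β : Fin n → ℝ → ℝ → ℝ)
    (g : Fin n → Fin n → ℝ → ℝ → ℝ) : Prop where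
  continuous_p : ∀ j, Continuous (Function.uncurry (p j))
  continuous_α : ∀ j, Continuous (Function.uncurry (α j))
  continuous_β : ∀ j, Continuous (Function.uncurry (β j))
  continuous_g : ∀ j k, Continuous (Function.uncurry (g j k))
  hasDerivAt_α : ∀ j lam x, HasDerivAt (α j lam) (p j lam x) x
  g_self : ∀ j, g j j = 0
  p_eq : ∀ j, ∀ lam ∈ Icc (-δ) δ, ∀ x ∈ Icc (0 : ℝ) 1, p j lam x = (d.a j x lam)⁻¹
  tau_eq : ∀ j, ∀ lam ∈ Icc (-δ) δ, ∀ ξ ∈ Icc (0 : ℝ) 1, ∀ x ∈ Icc (0 : ℝ) 1, ∀ t ω,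
    d.tau j ξ x t lam ω = t + (ω * α j lam ξ - ω * α j lam x)
  integral_eq : ∀ j, ∀ lam ∈ Icc (-δ) δ, ∀ ξ ∈ Icc (0 : ℝ) 1, ∀ x ∈ Icc (0 : ℝ) 1,
    ∫ η in x..ξ, d.dbu j j η lam / d.a j η lam = β j lam ξ - β j lam x
  g_eq : ∀ j k, k ≠ j → ∀ lam ∈ Icc (-δ) δ, ∀ x ∈ Icc (0 : ℝ) 1,
    g j k lam x = -(p j lam x * d.dbu j k x lam)

theorem HypData.StandingHyps.continuous_fderiv {n m : ℕ} {d : HypData n m} {δ : ℝ}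
    (h : d.StandingHyps δ) (j : Fin n) :
    Continuous fun y : ℝ × ℝ × (Fin n → ℝ) => fderiv ℝ (d.b j y.1 y.2.1) y.2.2 := by
  have hb := h.2.2.2.1 j
  refine (ContDiff.fderiv (𝕜 := ℝ) (n := 0) (m := (⊤ : ℕ∞))
    (f := fun (y : ℝ × ℝ × (Fin n → ℝ)) v => d.b j y.1 y.2.1 v)
    (g := fun y : ℝ × ℝ × (Fin n → ℝ) => y.2.2) ?_ ?_ ?_).continuous
  · exact hb.comp (by fun_prop : ContDiff ℝ (⊤ : ℕ∞)
      fun z : (ℝ × ℝ × (Fin n → ℝ)) × (Fin n → ℝ) => (z.1.1, z.1.2.1, z.2))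
  · fun_prop
  · simp

theorem HypData.StandingHyps.continuous_dbu {n m : ℕ} {d : HypData n m} {δ : ℝ}
    (h : d.StandingHyps δ) (j k : Fin n) :
    Continuous (Function.uncurry fun lam x => d.dbu j k x lam) := by
  have := (h.continuous_fderiv j).comp (by fun_prop : Continuous
    fun z : ℝ × ℝ => (z.2, z.1, (0 : Fin n → ℝ)))
  exact this.clm_apply continuous_const

theorem HypData.StandingHyps.exists_isModel {n m : ℕ} {d : HypData n m} {δ : ℝ}
    (h : d.StandingHyps δ) : ∃ p α β g, d.IsModel δ p α β g := by
  obtain ⟨-, -, ha, -, -, -, -, hδ, ha0⟩ := id h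
  have h1 : ∀ j, ContinuousOn (Function.uncurry fun lam x => (d.a j x lam)⁻¹)
      (Icc (-δ) δ ×ˢ Icc (0 : ℝ) 1) := fun j =>
    ContinuousOn.inv₀ ((ha j).continuous.comp continuous_swap).continuousOn
      fun y hy => ha0 j y.2 hy.2 y.1 hy.1
  choose p hp hpa using fun j => exists_continuous_eqOn_rectangle hδ.le (h1 j)
  have hq : ∀ j k, Continuous (Function.uncurry fun lam x => p j lam x * d.dbu j k x lam) :=
    fun j k => (hp j).mul (h.continuous_dbu j k)
  have hpj : ∀ j lam, Continuous (p j lam) := fun j lam =>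
    (hp j).comp (continuous_const.prodMk continuous_id)
  have hqj : ∀ j k lam, Continuous fun x => p j lam x * d.dbu j k x lam := fun j k lam =>
    (hq j k).comp (continuous_const.prodMk continuous_id)
  refine ⟨p, fun j lam x => ∫ η in (0 : ℝ)..x, p j lam η,
    fun j lam x => ∫ η in (0 : ℝ)..x, p j lam η * d.dbu j j η lam,
    fun j k lam x => if k = j then 0 else -(p j lam x * d.dbu j k x lam), ⟨hp,
      fun j => continuous_primitive_of_uncurry (hp j),
      fun j => continuous_primitive_of_uncurry (hq j j), fun j k => ?_, ?_, ?_, hpa, ?_, ?_, ?_⟩⟩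
  · by_cases hjk : k = j
    · simp only [hjk, if_true]
      exact continuous_const
    · simp only [hjk, if_false]
      exact (hq j k).neg
  · exact fun j lam x => intervalIntegral.integral_hasDerivAt_right
      ((hpj j lam).intervalIntegrable _ _) ((hpj j lam).stronglyMeasurableAtFilter _ _)
      (hpj j lam).continuousAt
  · intro j
    ext
    simp
  · intro j lam hlam ξ hξ x hx t ω
    rw [← mul_sub, intervalIntegral.integral_interval_sub_left
      ((hpj j lam).intervalIntegrable _ _) ((hpj j lam).intervalIntegrable _ _), HypData.tau,
      add_comm t]
    congr 2
    exact intervalIntegral.integral_congr fun η hη =>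
      (hpa j lam hlam η ((convex_Icc (0 : ℝ) 1).ordConnected.uIcc_subset hx hξ hη)).symm
  · intro j lam hlam ξ hξ x hx
    rw [intervalIntegral.integral_interval_sub_left
      ((hqj j j lam).intervalIntegrable _ _) ((hqj j j lam).intervalIntegrable _ _)]
    refine intervalIntegral.integral_congr fun η hη => ?_
    have := hpa j lam hlam η ((convex_Icc (0 : ℝ) 1).ordConnected.uIcc_subset hx hξ hη)
    simp only [this]
    rw [div_eq_inv_mul]
  · intro j k hjk lam _ x _
    simp [hjk]

end Model

section LinearPart

variable {n m : ℕ} {d : HypData n m} {δ : ℝ} {p α β : Fin n → ℝ → ℝ → ℝ}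
  {g : Fin n → Fin n → ℝ → ℝ → ℝ}

/-- The reflection coefficients between left- and right-running components. -/
def HypData.reflection (d : HypData n m) (j k : Fin n) : ℝ :=
  if (j : ℕ) < m then if m ≤ (k : ℕ) then d.r j k else 0
  else if (k : ℕ) < m then d.r j k else 0

theorem HypData.IsModel.continuous_β_right (M : d.IsModel δ p α β g) (j : Fin n) (lam : ℝ) :
    Continuous (β j lam) :=
  (M.continuous_β j).comp (continuous_const.prodMk continuous_id)

theorem HypData.IsModel.continuous_α_right (M : d.IsModel δ p α β g) (j : Fin n) (lam : ℝ) :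
    Continuous (α j lam) :=
  (M.continuous_α j).comp (continuous_const.prodMk continuous_id)

theorem HypData.IsModel.isBoundaryOperator (M : d.IsModel δ p α β g) {lam ω : ℝ}
    (hlam : lam ∈ Icc (-δ) δ) {C : Cspace n →L[ℝ] Cspace n}
    (hC : ∀ (u : Cspace n), ∀ x ∈ Set.Icc (0:ℝ) 1, ∀ (t : ℝ) (j : Fin n),
      ev (C u) x t j = d.CopRaw lam ω (ev u) x t j) :
    IsBoundaryOperator (xjv m) (fun j => β j lam) (fun j x => ω * α j lam x) d.reflection C := by
  intro u x hx t j
  have h0 : (0 : ℝ) ∈ Icc (0 : ℝ) 1 := by simp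
  have h1 : (1 : ℝ) ∈ Icc (0 : ℝ) 1 := by simp
  rw [hC u x hx t j, HypData.CopRaw]
  unfold HypData.reflection xjv HypData.cfac
  split_ifs
  · rw [M.integral_eq j lam hlam 0 h0 x hx, M.tau_eq j lam hlam 0 h0 x hx]
    simp only [ite_mul, zero_mul]
  · rw [M.integral_eq j lam hlam 1 h1 x hx, M.tau_eq j lam hlam 1 h1 x hx]
    simp only [ite_mul, zero_mul]

theorem le_csSup_of_isCompact_range {ι : Type*} [Finite ι] {f : ι → ℝ → ℝ} {q : ι → Prop}
    (hf : ∀ i, Continuous (f i)) {i : ι} (hi : q i) {x : ℝ} (hx : x ∈ Icc (0 : ℝ) 1) :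
    f i x ≤ sSup {y | ∃ i, q i ∧ ∃ x ∈ Icc (0 : ℝ) 1, y = f i x} := by
  refine le_csSup ?_ ⟨i, hi, x, hx, rfl⟩
  choose K hK using fun i =>
    (isCompact_Icc (a := (0 : ℝ)) (b := 1)).exists_bound_of_continuousOn (hf i).continuousOn
  obtain ⟨K', hK'⟩ := (Set.finite_range K).bddAbove
  refine ⟨K', ?_⟩
  rintro _ ⟨i, -, x, hx, rfl⟩
  exact (le_abs_self _).trans ((hK i x hx).trans (hK' ⟨i, rfl⟩))

theorem HypData.IsModel.exp_mul_sum_le_R0c (M : d.IsModel δ p α β g) (hδ : 0 ≤ δ) {j : Fin n}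
    (hj : (j : ℕ) < m) {x : ℝ} (hx : x ∈ Icc (0 : ℝ) 1) :
    rexp (β j 0 (xjv m j) - β j 0 x) * ∑ k, |d.reflection j k| ≤ d.R0c := by
  have h0 : (0 : ℝ) ∈ Icc (0 : ℝ) 1 := by simp
  refine (le_csSup_of_isCompact_range (q := fun j : Fin n => (j : ℕ) < m)
    (f := fun j x => rexp (β j 0 (xjv m j) - β j 0 x) * ∑ k, |d.reflection j k|)
    (fun i => ?_) hj hx).trans_eq ?_
  · have := M.continuous_β_right i 0
    fun_prop
  · unfold HypData.R0c HypData.R0lam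
    congr 1
    ext y
    refine exists_congr fun i => and_congr_right fun hi => exists_congr fun z =>
      and_congr_right fun hz => ?_
    rw [M.integral_eq i 0 ⟨by linarith, hδ⟩ z hz 0 h0, Finset.mul_sum]
    simp only [HypData.reflection, xjv, hi, if_true, neg_sub]
    refine Eq.congr_right (Finset.sum_congr rfl fun k _ => ?_)
    split_ifs <;> simp [mul_comm]

theorem HypData.IsModel.exp_mul_sum_le_R1c (M : d.IsModel δ p α β g) (hδ : 0 ≤ δ) {j : Fin n}
    (hj : m ≤ (j : ℕ)) {x : ℝ} (hx : x ∈ Icc (0 : ℝ) 1) :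
    rexp (β j 0 (xjv m j) - β j 0 x) * ∑ k, |d.reflection j k| ≤ d.R1c := by
  have h1 : (1 : ℝ) ∈ Icc (0 : ℝ) 1 := by simp
  refine (le_csSup_of_isCompact_range (q := fun j : Fin n => m ≤ (j : ℕ))
    (f := fun j x => rexp (β j 0 (xjv m j) - β j 0 x) * ∑ k, |d.reflection j k|)
    (fun i => ?_) hj hx).trans_eq ?_
  · have := M.continuous_β_right i 0
    fun_prop
  · unfold HypData.R1c HypData.R1lam
    congr 1
    ext y
    refine exists_congr fun i => and_congr_right fun hi => exists_congr fun z =>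
      and_congr_right fun hz => ?_
    rw [M.integral_eq i 0 ⟨by linarith, hδ⟩ 1 h1 z hz, Finset.mul_sum]
    simp only [HypData.reflection, xjv, not_lt.2 hi, if_false]
    refine Eq.congr_right (Finset.sum_congr rfl fun k _ => ?_)
    split_ifs <;> simp [mul_comm]

theorem HypData.R0c_nonneg (d : HypData n m) : 0 ≤ d.R0c := by
  refine Real.sSup_nonneg ?_
  rintro _ ⟨j, -, x, -, rfl⟩
  exact Finset.sum_nonneg fun k _ => by split_ifs <;> positivity

theorem HypData.R1c_nonneg (d : HypData n m) : 0 ≤ d.R1c := by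
  refine Real.sSup_nonneg ?_
  rintro _ ⟨j, -, x, -, rfl⟩
  exact Finset.sum_nonneg fun k _ => by split_ifs <;> positivity

theorem eventually_forall_mem_Icc_of_continuous {ι : Type*} [Finite ι] {a b : ℝ} {p₀ : ℝ}
    {f : ι → ℝ → ℝ → ℝ} (hf : ∀ i, Continuous (Function.uncurry (f i))) {U : Set ℝ}
    (hU : IsOpen U) (h : ∀ i, ∀ x ∈ Icc a b, f i p₀ x ∈ U) :
    ∀ᶠ lam in 𝓝 p₀, ∀ i, ∀ x ∈ Icc a b, f i lam x ∈ U :=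
  eventually_all.2 fun i => isCompact_Icc.eventually_forall_of_forall_eventually fun x hx =>
    (hf i).continuousAt.eventually (hU.mem_nhds (h i x hx))

/-- Dissipativity makes `C(λ,ω)²` a contraction for `λ` near `0`. -/
theorem HypData.IsModel.eventually_norm_comp_self_lt_one (M : d.IsModel δ p α β g) (hδ : 0 ≤ δ)
    (hdiss : d.R0c * d.R1c < 1) :
    ∀ᶠ lam in 𝓝 (0 : ℝ), ∀ (ω : ℝ) (C : Cspace n →L[ℝ] Cspace n),
      IsBoundaryOperator (xjv m) (fun j => β j lam) (fun j x => ω * α j lam x) d.reflection C →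
        ‖C ∘L C‖ < 1 := by
  obtain ⟨ε, hε, hlt⟩ : ∃ ε > 0, (d.R0c + ε) * (d.R1c + ε) < 1 := by
    have hc : ContinuousAt (fun ε : ℝ => (d.R0c + ε) * (d.R1c + ε)) 0 := by fun_prop
    have := hc.eventually (gt_mem_nhds (by simpa using hdiss))
    obtain ⟨ε, hε1, hε2⟩ := (frequently_gt_nhds (0 : ℝ)).and_eventually this |>.exists
    exact ⟨ε, hε1, hε2⟩
  have hR0 := d.R0c_nonneg
  have hR1 := d.R1c_nonneg
  have hcont : ∀ j : Fin n, Continuous (Function.uncurry fun lam x =>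
      rexp (β j lam (xjv m j) - β j lam x) * ∑ k, |d.reflection j k|) := fun j =>
    (Real.continuous_exp.comp (((M.continuous_β j).comp
      (continuous_fst.prodMk continuous_const)).sub (M.continuous_β j))).mul continuous_const
  have h0 := eventually_forall_mem_Icc_of_continuous (a := 0) (b := 1) (p₀ := 0)
    (ι := {j : Fin n // (j : ℕ) < m}) (fun j => hcont j.1) (U := Iio (d.R0c + ε)) isOpen_Iio
    fun j x hx => (M.exp_mul_sum_le_R0c hδ j.2 hx).trans_lt (lt_add_of_pos_right _ hε)
  have h1 := eventually_forall_mem_Icc_of_continuous (a := 0) (b := 1) (p₀ := 0)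
    (ι := {j : Fin n // m ≤ (j : ℕ)}) (fun j => hcont j.1) (U := Iio (d.R1c + ε)) isOpen_Iio
    fun j x hx => (M.exp_mul_sum_le_R1c hδ j.2 hx).trans_lt (lt_add_of_pos_right _ hε)
  filter_upwards [h0, h1] with lam h0 h1 ω C hC
  refine (hC.norm_comp_self_le xjv_mem_Icc (q := fun j => (j : ℕ) < m) (r₀ := d.R0c + ε)
    (r₁ := d.R1c + ε) (by positivity) (by positivity) (fun j k hjk => ?_)
    (fun j hj x hx => (h0 ⟨j, hj⟩ x hx).le)
    (fun j hj x hx => (h1 ⟨j, not_lt.1 hj⟩ x hx).le)).trans_lt hlt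
  unfold HypData.reflection at hjk
  by_cases hj : (j : ℕ) < m <;> by_cases hk : (k : ℕ) < m <;> simp_all

/-- The characteristic speeds stay distinct near `(λ, ω) = (0, 1)`. -/
theorem HypData.IsModel.eventually_ne (M : d.IsModel δ p α β g) (h : d.StandingHyps δ) :
    ∀ᶠ lam in 𝓝 (0 : ℝ), ∀ j k, j ≠ k → ∀ x ∈ Icc (0 : ℝ) 1, p j lam x ≠ p k lam x := by
  have hδ := h.2.2.2.2.2.2.2.1
  have := eventually_forall_mem_Icc_of_continuous (a := 0) (b := 1) (p₀ := 0)
    (ι := {j : Fin n × Fin n // j.1 ≠ j.2}) (f := fun j lam x => p j.1.1 lam x - p j.1.2 lam x)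
    (fun j => (M.continuous_p j.1.1).sub (M.continuous_p j.1.2)) (U := {0}ᶜ)
    isOpen_compl_singleton fun j x hx => ?_
  · filter_upwards [this] with lam hlam j k hjk x hx
    exact sub_ne_zero.1 (hlam ⟨(j, k), hjk⟩ x hx)
  · have h0 : (0 : ℝ) ∈ Icc (-δ) δ := ⟨by linarith, hδ.le⟩
    refine sub_ne_zero.2 ?_
    rw [M.p_eq _ 0 h0 x hx, M.p_eq _ 0 h0 x hx]
    exact fun he => h.2.2.2.2.2.1 _ _ j.2 x hx (inv_injective he)

/-- A family of operators given by jointly continuous formulas is strongly continuous. -/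
theorem tendsto_of_continuous_ev {Λ : Type*} [TopologicalSpace Λ] {p₀ : Λ} {T : Λ → Cspace n}
    {f : Fin n → Λ × ℝ × ℝ → ℝ} (hf : ∀ j, Continuous (f j))
    (hT : ∀ᶠ q in 𝓝 p₀, ∀ x ∈ Icc (0 : ℝ) 1, ∀ t j, ev (T q) x t j = f j (q, x, t)) :
    Tendsto T (𝓝 p₀) (𝓝 (T p₀)) := by
  refine Metric.tendsto_nhds.2 fun ε hε => ?_
  have key : ∀ᶠ q in 𝓝 p₀, ∀ j, ∀ y ∈ Icc (0 : ℝ) 1 ×ˢ Icc 0 (2 * π),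
      |f j (q, y) - f j (p₀, y)| < ε / 2 := by
    refine eventually_all.2 fun j =>
      (isCompact_Icc.prod isCompact_Icc).eventually_forall_of_forall_eventually fun y _ => ?_
    have hc : Continuous fun z : Λ × ℝ × ℝ => |f j z - f j (p₀, z.2)| :=
      ((hf j).sub ((hf j).comp (continuous_const.prodMk continuous_snd))).abs
    exact (hc.tendsto (p₀, y)).eventually (gt_mem_nhds (by simpa using half_pos hε))
  filter_upwards [key, hT] with q hq hTq
  rw [dist_eq_norm]
  refine (norm_le_of_abs_ev_le (half_pos hε).le fun x hx t ht j => ?_).trans_lt (half_lt_self hε)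
  rw [ev_sub, hTq x hx, hT.self_of_nhds x hx]
  exact (hq j (x, t) ⟨hx, ht⟩).le

theorem HypData.IsModel.tendsto_boundary (M : d.IsModel δ p α β g) (hδ : 0 < δ)
    {C : ℝ × ℝ → Cspace n →L[ℝ] Cspace n}
    (hC : ∀ q : ℝ × ℝ, q.1 ∈ Icc (-δ) δ → IsBoundaryOperator (xjv m) (fun j => β j q.1)
      (fun j x => q.2 * α j q.1 x) d.reflection (C q)) (u : Cspace n) :
    Tendsto (fun q => C q u) (𝓝 (0, 1)) (𝓝 (C (0, 1) u)) := by
  refine tendsto_of_continuous_ev (f := fun j y =>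
    rexp (β j y.1.1 (xjv m j) - β j y.1.1 y.2.1) * ∑ k, d.reflection j k * ev u (xjv m j)
      (y.2.2 + (y.1.2 * α j y.1.1 (xjv m j) - y.1.2 * α j y.1.1 y.2.1)) k) (fun j => ?_) ?_
  · have hα := M.continuous_α j
    have hβ := M.continuous_β j
    refine Continuous.mul ?_ (continuous_finsetSum _ fun k _ => continuous_const.mul
      (continuous_const.ev_apply u ?_ k))
    · exact Real.continuous_exp.comp ((hβ.comp (by fun_prop : Continuous
        fun y : (ℝ × ℝ) × ℝ × ℝ => (y.1.1, xjv m j))).sub (hβ.comp (by fun_prop : Continuous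
        fun y : (ℝ × ℝ) × ℝ × ℝ => (y.1.1, y.2.1))))
    · have h1 := hα.comp (by fun_prop : Continuous
        fun y : (ℝ × ℝ) × ℝ × ℝ => (y.1.1, xjv m j))
      have h2 := hα.comp (by fun_prop : Continuous
        fun y : (ℝ × ℝ) × ℝ × ℝ => (y.1.1, y.2.1))
      simp only [Function.comp_def, Function.uncurry] at h1 h2
      fun_prop
  · have : ∀ᶠ q : ℝ × ℝ in 𝓝 (0, 1), q.1 ∈ Icc (-δ) δ :=
      continuous_fst.continuousAt.eventually (Icc_mem_nhds (by simpa using hδ) hδ)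
    filter_upwards [this] with q hq x hx t j
    exact hC q hq u x hx t j

theorem HypData.IsModel.tendsto_coupling (M : d.IsModel δ p α β g) (hδ : 0 < δ)
    {D : ℝ × ℝ → Cspace n →L[ℝ] Cspace n}
    (hD : ∀ q : ℝ × ℝ, q.1 ∈ Icc (-δ) δ → IsCouplingOperator (xjv m) (fun j => β j q.1)
      (fun j x => q.2 * α j q.1 x) (fun j k => g j k q.1) (D q)) (u : Cspace n) :
    Tendsto (fun q => D q u) (𝓝 (0, 1)) (𝓝 (D (0, 1) u)) := by
  refine tendsto_of_continuous_ev (f := fun j y => ∫ ξ in (xjv m j)..y.2.1,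
    rexp (β j y.1.1 ξ - β j y.1.1 y.2.1) * ∑ k, g j k y.1.1 ξ * ev u ξ
      (y.2.2 + (y.1.2 * α j y.1.1 ξ - y.1.2 * α j y.1.1 y.2.1)) k) (fun j => ?_) ?_
  · refine intervalIntegral.continuous_parametric_intervalIntegral_of_continuous
      (f := fun (y : (ℝ × ℝ) × ℝ × ℝ) ξ => rexp (β j y.1.1 ξ - β j y.1.1 y.2.1) *
        ∑ k, g j k y.1.1 ξ * ev u ξ
          (y.2.2 + (y.1.2 * α j y.1.1 ξ - y.1.2 * α j y.1.1 y.2.1)) k) ?_ (by fun_prop)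
    have p1 : Continuous fun z : ((ℝ × ℝ) × ℝ × ℝ) × ℝ => (z.1.1.1, z.2) := by fun_prop
    have p2 : Continuous fun z : ((ℝ × ℝ) × ℝ × ℝ) × ℝ => (z.1.1.1, z.1.2.1) := by fun_prop
    refine Continuous.mul ?_ (continuous_finsetSum _ fun k _ =>
      ((M.continuous_g j k).comp p1).mul (continuous_snd.ev_apply u ?_ k))
    · exact Real.continuous_exp.comp (((M.continuous_β j).comp p1).sub
        ((M.continuous_β j).comp p2))
    · have p3 : Continuous fun z : ((ℝ × ℝ) × ℝ × ℝ) × ℝ => z.1.1.2 := by fun_prop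
      have p4 : Continuous fun z : ((ℝ × ℝ) × ℝ × ℝ) × ℝ => z.1.2.2 := by fun_prop
      exact p4.add ((p3.mul ((M.continuous_α j).comp p1)).sub
        (p3.mul ((M.continuous_α j).comp p2)))
  · have : ∀ᶠ q : ℝ × ℝ in 𝓝 (0, 1), q.1 ∈ Icc (-δ) δ :=
      continuous_fst.continuousAt.eventually (Icc_mem_nhds (by simpa using hδ) hδ)
    filter_upwards [this] with q hq x hx t j
    exact hD q hq u x hx t j

end LinearPart

section NonlinearPart

variable {n m : ℕ} {d : HypData n m} {δ : ℝ} {p α β : Fin n → ℝ → ℝ → ℝ}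
  {g : Fin n → Fin n → ℝ → ℝ → ℝ}

theorem HypData.StandingHyps.differentiable_b (h : d.StandingHyps δ) (j : Fin n) (x lam : ℝ) :
    Differentiable ℝ (d.b j x lam) := by
  have hb := (h.2.2.2.1 j).comp (by fun_prop : ContDiff ℝ (⊤ : ℕ∞)
    fun z : Fin n → ℝ => (x, lam, z))
  exact hb.differentiable (by simp)

theorem fderiv_b_apply (d : HypData n m) (j : Fin n) (x lam : ℝ) (z : Fin n → ℝ) :
    fderiv ℝ (d.b j x lam) 0 z = ∑ k, d.dbu j k x lam * z k := by
  conv_lhs => rw [pi_eq_sum_univ' z]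
  rw [map_sum]
  refine Finset.sum_congr rfl fun k _ => ?_
  rw [map_smul, smul_eq_mul, mul_comm]
  congr 2

/-- Uniform strict differentiability of the nonlinearity at `u = 0`. -/
theorem HypData.StandingHyps.exists_abs_ffun_sub_le (h : d.StandingHyps δ) {ε : ℝ} (hε : 0 < ε) :
    ∃ ρ > 0, ∀ j, ∀ lam ∈ Icc (-δ) δ, ∀ x ∈ Icc (0 : ℝ) 1, ∀ y z : Fin n → ℝ, ‖y‖ ≤ ρ →
      ‖z‖ ≤ ρ → |d.ffun j x lam y - d.ffun j x lam z
        + ∑ k, (if k ≠ j then d.dbu j k x lam * (y - z) k else 0)| ≤ ε * ‖y - z‖ := by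
  have key : ∀ᶠ v : Fin n → ℝ in 𝓝 0, ∀ j, ∀ q ∈ Icc (-δ) δ ×ˢ Icc (0 : ℝ) 1,
      ‖fderiv ℝ (d.b j q.2 q.1) v - fderiv ℝ (d.b j q.2 q.1) 0‖ < ε := by
    refine eventually_all.2 fun j =>
      (isCompact_Icc.prod isCompact_Icc).eventually_forall_of_forall_eventually fun q _ => ?_
    have hc := h.continuous_fderiv j
    have hc' : Continuous fun w : (Fin n → ℝ) × ℝ × ℝ =>
        ‖fderiv ℝ (d.b j w.2.2 w.2.1) w.1 - fderiv ℝ (d.b j w.2.2 w.2.1) 0‖ :=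
      ((hc.comp (by fun_prop : Continuous fun w : (Fin n → ℝ) × ℝ × ℝ =>
        (w.2.2, w.2.1, w.1))).sub (hc.comp (by fun_prop : Continuous
        fun w : (Fin n → ℝ) × ℝ × ℝ => (w.2.2, w.2.1, (0 : Fin n → ℝ))))).norm
    exact (hc'.tendsto (0, q)).eventually (gt_mem_nhds (by simpa using hε))
  obtain ⟨ρ, hρ, hball⟩ := Metric.nhds_basis_closedBall.eventually_iff.1 key
  refine ⟨ρ, hρ, fun j lam hlam x hx y z hy hz => ?_⟩
  have := (convex_closedBall (0 : Fin n → ℝ) ρ).norm_image_sub_le_of_norm_fderiv_le'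
    (f := d.b j x lam) (φ := fderiv ℝ (d.b j x lam) 0) (C := ε) (x := z) (y := y)
    (fun v _ => h.differentiable_b j x lam v)
    (fun v hv => (hball hv j (lam, x) ⟨hlam, hx⟩).le)
    (mem_closedBall_zero_iff.2 hz) (mem_closedBall_zero_iff.2 hy)
  rw [fderiv_b_apply, ← norm_neg] at this
  refine le_of_eq_of_le (congrArg (fun r : ℝ => |r|) ?_) this
  have hsum : ∑ k, d.dbu j k x lam * (y - z) k = d.dbu j j x lam * (y - z) j +
      ∑ k, (if k ≠ j then d.dbu j k x lam * (y - z) k else 0) := by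
    rw [← Finset.sum_filter, Finset.filter_ne', Finset.add_sum_erase _
      (fun k => d.dbu j k x lam * (y - z) k) (Finset.mem_univ j)]
  rw [hsum, HypData.ffun, HypData.ffun, Pi.sub_apply]
  ring

theorem HypData.StandingHyps.ffun_zero (h : d.StandingHyps δ) (j : Fin n) (x lam : ℝ) :
    d.ffun j x lam 0 = 0 := by
  simp [HypData.ffun, h.2.2.2.2.2.2.1 j x lam]

/-- The explicit form of `F` in terms of the globally continuous coefficients. -/
theorem HypData.IsModel.FopRaw_eq (M : d.IsModel δ p α β g) {lam ω : ℝ}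
    (hlam : lam ∈ Icc (-δ) δ) (U : ℝ → ℝ → Fin n → ℝ) {x : ℝ} (hx : x ∈ Icc (0 : ℝ) 1) (t : ℝ)
    (j : Fin n) : d.FopRaw lam ω U x t j = ∫ ξ in (xjv m j)..x,
      rexp (β j lam ξ - β j lam x) * (p j lam ξ *
        d.ffun j ξ lam (U ξ (t + (ω * α j lam ξ - ω * α j lam x)))) := by
  refine intervalIntegral.integral_congr fun ξ hξ => ?_
  have hξ' := (convex_Icc (0 : ℝ) 1).ordConnected.uIcc_subset (xjv_mem_Icc j) hx hξ
  rw [HypData.cfac, M.integral_eq j lam hlam ξ hξ' x hx, M.tau_eq j lam hlam ξ hξ' x hx,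
    M.p_eq j lam hlam ξ hξ', div_eq_mul_inv, mul_assoc]

theorem HypData.IsModel.exists_abs_exp_mul_le (M : d.IsModel δ p α β g) :
    ∃ K > 0, ∀ j, ∀ lam ∈ Icc (-δ) δ, ∀ ξ ∈ Icc (0 : ℝ) 1, ∀ x ∈ Icc (0 : ℝ) 1,
      |rexp (β j lam ξ - β j lam x) * p j lam ξ| ≤ K := by
  have hc : ∀ j, Continuous fun y : ℝ × ℝ × ℝ =>
      rexp (β j y.1 y.2.1 - β j y.1 y.2.2) * p j y.1 y.2.1 := fun j => by
    have p1 : Continuous fun y : ℝ × ℝ × ℝ => (y.1, y.2.1) := by fun_prop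
    have p2 : Continuous fun y : ℝ × ℝ × ℝ => (y.1, y.2.2) := by fun_prop
    exact (Real.continuous_exp.comp (((M.continuous_β j).comp p1).sub
      ((M.continuous_β j).comp p2))).mul ((M.continuous_p j).comp p1)
  choose K hK using fun j => ((isCompact_Icc (a := -δ) (b := δ)).prod
    ((isCompact_Icc (a := (0 : ℝ)) (b := 1)).prod
      (isCompact_Icc (a := (0 : ℝ)) (b := 1)))).exists_bound_of_continuousOn (hc j).continuousOn
  obtain ⟨K', hK'⟩ := (Set.finite_range K).bddAbove
  refine ⟨max K' 1, by positivity, fun j lam hlam ξ hξ x hx => ?_⟩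
  exact ((hK j (lam, ξ, x) ⟨hlam, hξ, hx⟩).trans (hK' ⟨j, rfl⟩)).trans (le_max_left _ _)

theorem HypData.IsModel.continuous_nemytskii (M : d.IsModel δ p α β g) (h : d.StandingHyps δ)
    (u : Cspace n) (lam ω x t : ℝ) (j : Fin n) : Continuous fun ξ =>
      rexp (β j lam ξ - β j lam x) * (p j lam ξ *
        d.ffun j ξ lam (ev u ξ (t + (ω * α j lam ξ - ω * α j lam x)))) := by
  have hα := M.continuous_α_right j lam
  have hβ := M.continuous_β_right j lam
  have hp : Continuous (p j lam) :=
    (M.continuous_p j).comp (continuous_const.prodMk continuous_id)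
  have hev : Continuous fun ξ => ev u ξ (t + (ω * α j lam ξ - ω * α j lam x)) :=
    (continuous_ev u).comp (by fun_prop : Continuous
      fun ξ => (ξ, t + (ω * α j lam ξ - ω * α j lam x)))
  have hdb : Continuous fun ξ => d.dbu j j ξ lam :=
    (h.continuous_dbu j j).comp (by fun_prop : Continuous fun ξ : ℝ => (lam, ξ))
  have hb : Continuous fun ξ => d.b j ξ lam (ev u ξ (t + (ω * α j lam ξ - ω * α j lam x))) :=
    (h.2.2.2.1 j).continuous.comp (continuous_id.prodMk (continuous_const.prodMk hev))
  unfold HypData.ffun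
  have hevj := (continuous_apply j).comp hev
  simp only [Function.comp_def] at hevj
  fun_prop

/-- Uniform strict differentiability of `F` at `u = 0`, with the explicit derivative. -/
theorem HypData.IsModel.exists_abs_sub_coupling_le (M : d.IsModel δ p α β g)
    (h : d.StandingHyps δ) {F : ℝ → ℝ → Cspace n → Cspace n}
    (hF : ∀ (lam ω : ℝ) (u : Cspace n), ∀ x ∈ Set.Icc (0:ℝ) 1, ∀ (t : ℝ) (j : Fin n),
      ev (F lam ω u) x t j = d.FopRaw lam ω (ev u) x t j) {ε : ℝ} (hε : 0 < ε) :
    ∃ ρ > 0, ∀ lam ∈ Icc (-δ) δ, ∀ ω, ∀ u v : Cspace n, ‖u‖ ≤ ρ → ‖v‖ ≤ ρ →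
      ∀ x ∈ Icc (0 : ℝ) 1, ∀ t j, |ev (F lam ω u) x t j - ev (F lam ω v) x t j -
        ∫ ξ in (xjv m j)..x, rexp (β j lam ξ - β j lam x) * ∑ k, g j k lam ξ *
          ev (u - v) ξ (t + (ω * α j lam ξ - ω * α j lam x)) k| ≤ ε * ‖u - v‖ := by
  obtain ⟨K, hK, hKle⟩ := M.exists_abs_exp_mul_le
  obtain ⟨ρ, hρ, hρle⟩ := h.exists_abs_ffun_sub_le (div_pos hε hK)
  refine ⟨ρ, hρ, fun lam hlam ω u v hu hv x hx t j => ?_⟩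
  have hα := M.continuous_α_right j lam
  have hβ := M.continuous_β_right j lam
  have hg : ∀ k, Continuous (g j k lam) := fun k =>
    (M.continuous_g j k).comp (continuous_const.prodMk continuous_id)
  have hI3 : Continuous fun ξ => rexp (β j lam ξ - β j lam x) * ∑ k, g j k lam ξ *
      ev (u - v) ξ (t + (ω * α j lam ξ - ω * α j lam x)) k :=
    continuous_coupling (by fun_prop) hg (by fun_prop) _ _
  have hI1 := M.continuous_nemytskii h u lam ω x t j
  have hI2 := M.continuous_nemytskii h v lam ω x t j
  have hI12 := hI1.fun_sub hI2
  rw [hF _ _ _ x hx, hF _ _ _ x hx, M.FopRaw_eq hlam _ hx, M.FopRaw_eq hlam _ hx,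
    ← intervalIntegral.integral_sub (hI1.intervalIntegrable _ _) (hI2.intervalIntegrable _ _),
    ← intervalIntegral.integral_sub (hI12.intervalIntegrable _ _)
      (hI3.intervalIntegrable _ _), ← Real.norm_eq_abs]
  refine (intervalIntegral.norm_integral_le_of_norm_le_const (C := ε * ‖u - v‖)
    fun ξ hξ => ?_).trans ?_
  · have hξ' := (convex_Icc (0 : ℝ) 1).ordConnected.uIcc_subset (xjv_mem_Icc j) hx
      (uIoc_subset_uIcc hξ)
    set τ := t + (ω * α j lam ξ - ω * α j lam x)
    have h1 := hρle j lam hlam ξ hξ' (ev u ξ τ) (ev v ξ τ) ((norm_ev_le u ξ τ).trans hu)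
      ((norm_ev_le v ξ τ).trans hv)
    have h2 : ‖ev u ξ τ - ev v ξ τ‖ ≤ ‖u - v‖ := norm_ev_le (u - v) ξ τ
    have h3 : ∑ k, g j k lam ξ * ev (u - v) ξ τ k = -(p j lam ξ *
        ∑ k, (if k ≠ j then d.dbu j k ξ lam * (ev u ξ τ - ev v ξ τ) k else 0)) := by
      rw [Finset.mul_sum, ← Finset.sum_neg_distrib]
      refine Finset.sum_congr rfl fun k _ => ?_
      by_cases hkj : k = j
      · simp [hkj, M.g_self]
      · rw [M.g_eq j k hkj lam hlam ξ hξ', if_pos hkj, ev_sub, Pi.sub_apply]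
        ring
    rw [h3, Real.norm_eq_abs]
    calc _ = |rexp (β j lam ξ - β j lam x) * p j lam ξ| *
          |d.ffun j ξ lam (ev u ξ τ) - d.ffun j ξ lam (ev v ξ τ) +
            ∑ k, (if k ≠ j then d.dbu j k ξ lam * (ev u ξ τ - ev v ξ τ) k else 0)| := by
          rw [← abs_mul]
          congr 1
          ring
      _ ≤ K * (ε / K * ‖u - v‖) := mul_le_mul (hKle j lam hlam ξ hξ' x hx)
          (h1.trans (by gcongr)) (abs_nonneg _) hK.le
      _ = ε * ‖u - v‖ := by field_simp
  · refine mul_le_of_le_one_right (by positivity) ?_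
    have h1 := xjv_mem_Icc (m := m) j
    rw [abs_le]
    constructor <;> linarith [h1.1, h1.2, hx.1, hx.2]

theorem HypData.StandingHyps.map_zero_eq_zero (h : d.StandingHyps δ)
    {F : ℝ → ℝ → Cspace n → Cspace n}
    (hF : ∀ (lam ω : ℝ) (u : Cspace n), ∀ x ∈ Set.Icc (0:ℝ) 1, ∀ (t : ℝ) (j : Fin n),
      ev (F lam ω u) x t j = d.FopRaw lam ω (ev u) x t j) (lam ω : ℝ) : F lam ω 0 = 0 := by
  refine norm_le_zero_iff.1 (norm_le_of_abs_ev_le le_rfl fun x hx t _ j => ?_)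
  rw [hF _ _ _ x hx, HypData.FopRaw]
  have h0 : ∀ ξ s, ev (0 : Cspace n) ξ s = 0 := fun _ _ => rfl
  simp [h0, h.ffun_zero]

theorem HypData.IsModel.isCouplingOperator (M : d.IsModel δ p α β g) (h : d.StandingHyps δ)
    {F : ℝ → ℝ → Cspace n → Cspace n}
    (hF : ∀ (lam ω : ℝ) (u : Cspace n), ∀ x ∈ Set.Icc (0:ℝ) 1, ∀ (t : ℝ) (j : Fin n),
      ev (F lam ω u) x t j = d.FopRaw lam ω (ev u) x t j) {lam ω : ℝ} (hlam : lam ∈ Icc (-δ) δ)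
    {D : Cspace n →L[ℝ] Cspace n} (hD : HasFDerivAt (F lam ω) D 0) :
    IsCouplingOperator (xjv m) (fun j => β j lam) (fun j x => ω * α j lam x)
      (fun j k => g j k lam) D := by
  intro u x hx t j
  refine eq_of_abs_sub_le_all fun ε hε => ?_
  set I := ∫ ξ in (xjv m j)..x, rexp (β j lam ξ - β j lam x) * ∑ k, g j k lam ξ *
    ev u ξ (t + (ω * α j lam ξ - ω * α j lam x)) k with hI
  set η := ε / (2 * (‖u‖ + 1)) with hη
  have hu := norm_nonneg u
  have hη0 : 0 < η := by positivity
  obtain ⟨ρ, hρ, hle⟩ := M.exists_abs_sub_coupling_le h hF hη0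
  have h1 : ∀ᶠ v : Cspace n in 𝓝 0, ‖F lam ω v - F lam ω 0 - D (v - 0)‖ ≤ η * ‖v - 0‖ :=
    (hasFDerivAt_iff_isLittleO.1 hD).def hη0
  have h2 : ∀ᶠ v : Cspace n in 𝓝 0, ‖v‖ ≤ ρ := by
    filter_upwards [Metric.closedBall_mem_nhds (0 : Cspace n) hρ] with v hv
    exact mem_closedBall_zero_iff.1 hv
  have h3 : Tendsto (fun s : ℝ => s • u) (𝓝 0) (𝓝 0) := by
    have : Continuous fun s : ℝ => s • u := by fun_prop
    simpa using this.tendsto 0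
  obtain ⟨s, hs0, hs1, hs2⟩ :=
    ((frequently_gt_nhds (0 : ℝ)).and_eventually (h3.eventually (h1.and h2))).exists
  have h4 := hle lam hlam ω (s • u) 0 hs2 (by simpa using hρ.le) x hx t j
  have h5 := (abs_ev_le (F lam ω (s • u) - F lam ω 0 - D (s • u - 0)) x t j).trans hs1
  rw [sub_zero, norm_smul, Real.norm_eq_abs, abs_of_pos hs0] at h4 h5
  have h6 : ∫ ξ in (xjv m j)..x, rexp (β j lam ξ - β j lam x) * ∑ k, g j k lam ξ *
      ev (s • u) ξ (t + (ω * α j lam ξ - ω * α j lam x)) k = s * I := by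
    rw [hI, ← intervalIntegral.integral_const_mul]
    refine intervalIntegral.integral_congr fun ξ _ => ?_
    rw [mul_left_comm, Finset.mul_sum _ _ s]
    congr 1
    refine Finset.sum_congr rfl fun k _ => ?_
    exact mul_left_comm _ _ _
  rw [h6] at h4
  rw [ev_sub, ev_sub, map_smul, show ev (s • D u) x t j = s * ev (D u) x t j from rfl] at h5
  have h7 : s * |ev (D u) x t j - I| ≤ s * ε := by
    rw [← abs_of_pos hs0, ← abs_mul, abs_of_pos hs0, mul_sub]
    have h8 : 2 * (η * ‖u‖) ≤ ε := by
      rw [hη]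
      rw [div_mul_eq_mul_div, mul_div_assoc', div_le_iff₀ (by positivity)]
      nlinarith
    have h9 : s * (2 * (η * ‖u‖)) ≤ s * ε := mul_le_mul_of_nonneg_left h8 hs0.le
    rw [abs_le] at h4 h5 ⊢
    constructor <;> linarith [h4.1, h4.2, h5.1, h5.2]
  exact le_of_mul_le_mul_left h7 hs0

end NonlinearPart

/-- **Local unique solvability of the infinite-dimensional part of the Liapunov–Schmidt
system:** there exists `δ₃ ∈ (0,δ₂)` such that for all `λ ∈ [−δ₃,δ₃]`, `ω ∈ [1−δ₃,1+δ₃]`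
and `v ∈ im Q` with `‖v‖_∞ ≤ δ₃` there is exactly one `w ∈ ker Q` with `‖w‖_∞ ≤ δ₃` solving
`(I−P)((I−C(λ,ω))(v+w) − F(λ,ω,v+w)) = 0`. -/
theorem local_solution_infinite_part {n m : ℕ} (d : HypData n m) (δ0 : ℝ)
    (hyp : d.StandingHyps δ0) (hdiss : d.R0c * d.R1c < 1)
    (h1 : d.HypH1) (h2 : d.HypH2) (h4 : d.HypH4)
    (v0 w0 : Fin n → ℝ → ℂ)
    (hv0 : d.IsEV 0 Complex.I v0) (hv0n : Nontriv v0)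
    (hw0 : d.IsAEV 0 (-Complex.I) w0) (hw0n : Nontriv w0)
    (hnorm : NormalizedPair v0 w0)
    (Cop : ℝ → ℝ → Cspace n →L[ℝ] Cspace n)
    (hCop : ∀ (lam ω : ℝ) (u : Cspace n), ∀ x ∈ Set.Icc (0:ℝ) 1, ∀ (t : ℝ) (j : Fin n),
      ev (Cop lam ω u) x t j = d.CopRaw lam ω (ev u) x t j)
    (Fop : ℝ → ℝ → Cspace n → Cspace n)
    (hFop : ∀ (lam ω : ℝ) (u : Cspace n), ∀ x ∈ Set.Icc (0:ℝ) 1, ∀ (t : ℝ) (j : Fin n),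
      ev (Fop lam ω u) x t j = d.FopRaw lam ω (ev u) x t j)
    (DF : ℝ → ℝ → Cspace n → Cspace n →L[ℝ] Cspace n)
    (hDF : ∀ (lam ω : ℝ) (u : Cspace n), HasFDerivAt (Fop lam ω) (DF lam ω u) u)
    (P Q : Cspace n →L[ℝ] Cspace n)
    (hPproj : P.comp P = P) (hQproj : Q.comp Q = Q)
    (hPker : LinearMap.ker P.toLinearMap =
      LinearMap.range (ContinuousLinearMap.id ℝ (Cspace n) - Cop 0 1 - DF 0 1 0).toLinearMap)
    (hQrange : LinearMap.range Q.toLinearMap =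
      LinearMap.ker (ContinuousLinearMap.id ℝ (Cspace n) - Cop 0 1 - DF 0 1 0).toLinearMap)
    (δ2 c2 : ℝ) (hδ2pos : 0 < δ2) (hδ2le : δ2 ≤ δ0) (hc2 : 0 < c2)
    (hδ2bound : ∀ lam ∈ Set.Icc (-δ2) δ2, ∀ ω ∈ Set.Icc (1-δ2) (1+δ2),
      ∀ u : Cspace n, ‖u‖ ≤ δ2 →
        ∀ w ∈ LinearMap.ker Q.toLinearMap,
          c2 * ‖w‖ ≤ ‖(ContinuousLinearMap.id ℝ (Cspace n) - P)
            ((ContinuousLinearMap.id ℝ (Cspace n) - Cop lam ω - DF lam ω u) w)‖) :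
    ∃ δ3 : ℝ, 0 < δ3 ∧ δ3 < δ2 ∧
      ∀ lam ∈ Set.Icc (-δ3) δ3, ∀ ω ∈ Set.Icc (1-δ3) (1+δ3),
        ∀ v ∈ LinearMap.range Q.toLinearMap, ‖v‖ ≤ δ3 →
          ∃! w : Cspace n, w ∈ LinearMap.ker Q.toLinearMap ∧ ‖w‖ ≤ δ3 ∧
            (ContinuousLinearMap.id ℝ (Cspace n) - P)
              ((v + w) - Cop lam ω (v + w) - Fop lam ω (v + w)) = 0 := by
  have hδ0 : 0 < δ0 := hyp.2.2.2.2.2.2.2.1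
  obtain ⟨p, α, β, g, M⟩ := hyp.exists_isModel
  have hbox : ∀ r > 0, ∀ᶠ q : ℝ × ℝ in 𝓝 (0, 1), q.1 ∈ Icc (-r) r ∧ q.2 ∈ Icc (1 - r) (1 + r) :=
    fun r hr => prod_mem_nhds (Icc_mem_nhds (by linarith) hr)
      (Icc_mem_nhds (by linarith) (by linarith))
  have hB : ∀ q : ℝ × ℝ, q.1 ∈ Icc (-δ0) δ0 → IsBoundaryOperator (xjv m) (fun j => β j q.1)
      (fun j x => q.2 * α j q.1 x) d.reflection (Cop q.1 q.2) := fun q hq =>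
    M.isBoundaryOperator hq (hCop q.1 q.2)
  have hD : ∀ q : ℝ × ℝ, q.1 ∈ Icc (-δ0) δ0 → IsCouplingOperator (xjv m) (fun j => β j q.1)
      (fun j x => q.2 * α j q.1 x) (fun j k => g j k q.1) (DF q.1 q.2 0) := fun q hq =>
    M.isCouplingOperator hyp hFop hq (hDF q.1 q.2 0)
  have hres : ∀ᶠ q : ℝ × ℝ in 𝓝 (0, 1), ∃ R : Cspace n →L[ℝ] Cspace n,
      (∀ u, R (u - Cop q.1 q.2 u) = u) ∧ ∀ u, R u - Cop q.1 q.2 (R u) = u := by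
    have := (continuous_fst (X := ℝ) (Y := ℝ)).continuousAt (x := (0, 1)) |>.eventually
      (M.eventually_norm_comp_self_lt_one hδ0.le hdiss)
    filter_upwards [this, hbox δ0 hδ0] with q hq hq'
    exact exists_resolvent_of_norm_comp_self_lt_one (hq q.2 _ (hB q hq'.1))
  obtain ⟨R, hR⟩ := hres.choice
  have hcomp : ∀ᶠ q : ℝ × ℝ in 𝓝 (0, 1), (∀ u, R q (u - Cop q.1 q.2 u) = u) ∧
      (∀ u, R q u - Cop q.1 q.2 (R q u) = u) ∧
      IsCompactOperator (DF q.1 q.2 0 ∘L R q ∘L DF q.1 q.2 0) := by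
    have hne := (continuous_fst (X := ℝ) (Y := ℝ)).continuousAt (x := (0, 1)) |>.eventually
      (M.eventually_ne hyp)
    filter_upwards [hR, hne, hbox δ0 hδ0, hbox (1 / 2) (by norm_num)] with q hRq hneq hq hq'
    have hω : q.2 ≠ 0 := by linarith [hq'.2.1] |> fun h : 0 < q.2 => h.ne'
    refine ⟨hRq.1, hRq.2, ?_⟩
    refine IsCouplingOperator.isCompactOperator_comp_resolvent
      (φ' := fun j x => q.2 * p j q.1 x) (hB q hq.1) (hD q hq.1) xjv_mem_Icc
      (fun j => M.continuous_β_right j q.1) (fun j x => (M.hasDerivAt_α j q.1 x).const_mul q.2)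
      (fun j => ?_) (fun j k => ?_) (fun j => ?_) (fun j k hjk x hx => ?_) hRq.2
    · exact continuous_const.mul
        ((M.continuous_p j).comp (continuous_const.prodMk continuous_id))
    · exact (M.continuous_g j k).comp (continuous_const.prodMk continuous_id)
    · simp [M.g_self]
    · exact fun he => hneq j k hjk x hx (mul_left_cancel₀ hω he)
  have hcont : ∀ u, Tendsto (fun q : ℝ × ℝ => u - Cop q.1 q.2 u - DF q.1 q.2 0 u) (𝓝 (0, 1))
      (𝓝 (u - Cop 0 1 u - DF 0 1 0 u)) :=
    fun u => (tendsto_const_nhds.sub (M.tendsto_boundary hδ0 hB u)).sub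
      (M.tendsto_coupling hδ0 hD u)
  have hstrict : ∀ ε > 0, ∃ ρ > 0, ∀ᶠ q : ℝ × ℝ in 𝓝 (0, 1), ∀ u v, ‖u‖ ≤ ρ → ‖v‖ ≤ ρ →
      ‖Fop q.1 q.2 u - Fop q.1 q.2 v - (DF q.1 q.2 0 u - DF q.1 q.2 0 v)‖ ≤ ε * ‖u - v‖ := by
    intro ε hε
    obtain ⟨ρ, hρ, hle⟩ := M.exists_abs_sub_coupling_le hyp hFop hε
    refine ⟨ρ, hρ, ?_⟩
    filter_upwards [hbox δ0 hδ0] with q hq u v hu hv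
    refine norm_le_of_abs_ev_le (by positivity) fun x hx t _ j => ?_
    rw [← map_sub, ev_sub, ev_sub, hD q hq.1 (u - v) x hx]
    exact hle q.1 hq.1 q.2 u v hu hv x hx t j
  have hbd : ∀ᶠ q : ℝ × ℝ in 𝓝 (0, 1), ∀ w, Q w = 0 → c2 * ‖w‖ ≤
      ‖(w - Cop q.1 q.2 w - DF q.1 q.2 0 w) - P (w - Cop q.1 q.2 w - DF q.1 q.2 0 w)‖ := by
    filter_upwards [hbox δ2 hδ2pos] with q hq w hw
    exact hδ2bound q.1 hq.1 q.2 hq.2 0 (by simpa using hδ2pos.le) w hw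
  obtain ⟨ρ, hρ, hev⟩ := eventually_existsUnique_ker (p₀ := ((0, 1) : ℝ × ℝ))
    (C := fun q => Cop q.1 q.2) (D := fun q => DF q.1 q.2 0) (R := R)
    (F := fun q => Fop q.1 q.2) (P := P) (Q := Q) hc2 hcomp hcont
    (Eventually.of_forall fun q => hyp.map_zero_eq_zero hFop q.1 q.2) hstrict hPproj hQproj hPker
    hQrange hbd
  obtain ⟨r, hr, hrr⟩ : ∃ r > 0, ∀ q : ℝ × ℝ, q.1 ∈ Icc (-r) r → q.2 ∈ Icc (1 - r) (1 + r) →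
      ∀ δ, 0 < δ → δ ≤ ρ → ∀ v ∈ LinearMap.range Q.toLinearMap, ‖v‖ ≤ δ →
      ∃! w, Q w = 0 ∧ ‖w‖ ≤ δ ∧ ((v + w) - Cop q.1 q.2 (v + w) - Fop q.1 q.2 (v + w)) -
        P ((v + w) - Cop q.1 q.2 (v + w) - Fop q.1 q.2 (v + w)) = 0 := by
    obtain ⟨r, hr, hball⟩ := Metric.nhds_basis_closedBall.eventually_iff.1 hev
    refine ⟨r, hr, fun q hq1 hq2 => hball ?_⟩
    rw [← closedBall_prod_same, Real.closedBall_eq_Icc, Real.closedBall_eq_Icc]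
    exact ⟨by simpa using hq1, hq2⟩
  have hmin : 0 < min (min ρ r) δ2 := by positivity
  have hρ' : min (min ρ r) δ2 ≤ ρ := (min_le_left _ _).trans (min_le_left _ _)
  have hr' : min (min ρ r) δ2 ≤ r := (min_le_left _ _).trans (min_le_right _ _)
  have hδ' : min (min ρ r) δ2 ≤ δ2 := min_le_right _ _
  refine ⟨min (min ρ r) δ2 / 2, by positivity, by linarith, fun lam hlam ω hω v hv hvn => ?_⟩
  exact hrr (lam, ω) ⟨by linarith [hlam.1], by linarith [hlam.2]⟩
    ⟨by linarith [hω.1], by linarith [hω.2]⟩ _ (by positivity) (by linarith) v hv hvn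
end

section
/- Let U be a Banach space, (u_n) a converging sequence in U, and (A_n) a sequence of bounded linear operators on U such that for some c < 1 one has ‖A_n u‖ ≤ c‖u‖ for all u ∈ U and n, and such that for every u ∈ U the sequence (A_n u) converges in U. If (v_n) is a sequence in U with v_{n+1} = A_n v_n + u_n for all n, then (v_n) converges in U. -/
open Filter Topology in
/-- A nonnegative real sequence with `a (k + 1) ≤ c * a k + e k`, where `0 ≤ c < 1` and `e` tends
to zero, tends to zero. -/
theorem tendsto_zero_of_le_mul_add {a e : ℕ → ℝ} {c : ℝ} (hc0 : 0 ≤ c) (hc1 : c < 1)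
    (ha : ∀ k, 0 ≤ a k) (he : Tendsto e atTop (𝓝 0)) (h : ∀ k, a (k + 1) ≤ c * a k + e k) :
    Tendsto a atTop (𝓝 0) := by
  refine tendsto_order.2 ⟨fun b hb => Eventually.of_forall fun k => hb.trans_le (ha k), ?_⟩
  intro ε hε
  have hδ : 0 < (1 - c) * (ε / 2) := mul_pos (by linarith) (by linarith)
  obtain ⟨N, hN⟩ := eventually_atTop.1 (he.eventually (gt_mem_nhds hδ))
  have bound : ∀ j, a (j + N) ≤ c ^ j * a N + ε / 2 := by
    intro j
    induction j with
    | zero => simp only [zero_add, pow_zero, one_mul]; linarith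
    | succ j ih =>
      have h1 := h (j + N)
      have h2 := hN (j + N) (by omega)
      have h3 := mul_le_mul_of_nonneg_left ih hc0
      rw [show j + 1 + N = j + N + 1 by omega, pow_succ]
      linarith
  have hpow : Tendsto (fun j => c ^ j * a N) atTop (𝓝 0) := by
    simpa using (tendsto_pow_atTop_nhds_zero_of_lt_one hc0 hc1).mul_const (a N)
  have hev : ∀ᶠ j in atTop, a (j + N) < ε := by
    filter_upwards [hpow.eventually (gt_mem_nhds (half_pos hε))] with j hj
    linarith [bound j]
  obtain ⟨M, hM⟩ := eventually_atTop.1 hev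
  refine eventually_atTop.2 ⟨M + N, fun k hk => ?_⟩
  simpa [Nat.sub_add_cancel (show N ≤ k by omega)] using hM (k - N) (by omega)

/-- **Linear fiber contraction principle.**
Let `U` be a Banach space, `(u_n)` a converging sequence in `U`, and `(A_n)` a sequence of
bounded linear operators on `U` such that for some `c < 1` one has `‖A_n u‖ ≤ c‖u‖` for all
`u ∈ U` and all `n`, and such that for every `u ∈ U` the sequence `(A_n u)` converges in `U`.
If `(v_n)` is a sequence in `U` with `v_{n+1} = A_n v_n + u_n` for all `n`, then `(v_n)`
converges in `U`. -/
theorem fiber_contraction_linear {𝕜 : Type*} [RCLike 𝕜]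
    {U : Type*} [NormedAddCommGroup U] [NormedSpace 𝕜 U] [CompleteSpace U]
    (u : ℕ → U) (hu : ∃ l, Filter.Tendsto u Filter.atTop (nhds l))
    (A : ℕ → U →L[𝕜] U) (c : ℝ) (hc : c < 1)
    (hA : ∀ (k : ℕ) (x : U), ‖A k x‖ ≤ c * ‖x‖)
    (hAconv : ∀ x : U, ∃ l, Filter.Tendsto (fun k => A k x) Filter.atTop (nhds l))
    (v : ℕ → U) (hv : ∀ k, v (k + 1) = A k (v k) + u k) :
    ∃ l, Filter.Tendsto v Filter.atTop (nhds l) := by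
  obtain ⟨l, hl⟩ := hu
  choose B hB using hAconv
  let K : NNReal := c.toNNReal
  have hK1 : (K : ℝ) < 1 := by simpa [K] using hc
  have hAK (k : ℕ) (x : U) : ‖A k x‖ ≤ K * ‖x‖ :=
    (hA k x).trans (mul_le_mul_of_nonneg_right (Real.le_coe_toNNReal c) (norm_nonneg x))
  have hF : ContractingWith K fun x => B x + l := by
    refine ⟨by exact_mod_cast hK1, LipschitzWith.of_dist_le_mul fun x y => ?_⟩
    rw [dist_add_right, dist_eq_norm, dist_eq_norm]
    refine le_of_tendsto ((hB x).sub (hB y)).norm (Filter.Eventually.of_forall fun k => ?_)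
    rw [← map_sub]
    exact hAK k (x - y)
  let w := hF.fixedPoint
  have hw : B w + l = w := hF.fixedPoint_isFixedPt
  have he : Filter.Tendsto (fun k => ‖A k w + u k - w‖) Filter.atTop (nhds 0) := by
    simpa [hw] using (((hB w).add hl).sub_const w).norm
  refine ⟨w, tendsto_iff_norm_sub_tendsto_zero.2 <|
    tendsto_zero_of_le_mul_add K.coe_nonneg hK1 (fun k => norm_nonneg _) he fun k => ?_⟩
  calc ‖v (k + 1) - w‖ = ‖A k (v k - w) + (A k w + u k - w)‖ := by
        rw [hv, map_sub]; congr 1; abel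
    _ ≤ ‖A k (v k - w)‖ + ‖A k w + u k - w‖ := norm_add_le _ _
    _ ≤ K * ‖v k - w‖ + ‖A k w + u k - w‖ := by gcongr; exact hAK k _
end
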